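/- Let Σ ⊂ ℙ³ be a smooth projective surface, P ⊂ ℙ³ a plane with P ≠ Σ, and C ⊆ P an irreducible curve which is not a line and is not contained in Σ. Then for a general point p ∈ ℙ³ \ P, the curve K_{C,p} ∩ Σ is irreducible. -/

import Mathlib

open scoped LinearAlgebra.Projectivization
open Projectivization MvPolynomial

/-- Projective 3-space over ℂ. -/
abbrev P3 := ℙ ℂ (Fin 4 → ℂ)

/-- The linear span of two points of ℙ³, i.e. the projective line through them
(or the point itself if they coincide). -/
def projSpan (a b : P3) : Set P3 :=
  {x | Projectivization.submodule x ≤ Projectivization.submodule a ⊔ Projectivization.submodule b}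

/-- The cone over a set `C` with vertex `p`: the union of all lines joining `p`
to points of `C`. -/
def cone (C : Set P3) (p : P3) : Set P3 := ⋃ q ∈ C, projSpan q p

/-- A plane in ℙ³ (projectivization of a 3-dimensional linear subspace). -/
def IsPlane (P : Set P3) : Prop :=
  ∃ W : Submodule ℂ (Fin 4 → ℂ), Module.finrank ℂ W = 3 ∧
    P = {x | Projectivization.submodule x ≤ W}

/-- A line in ℙ³ (projectivization of a 2-dimensional linear subspace). -/
def IsLine (L : Set P3) : Prop :=
  ∃ W : Submodule ℂ (Fin 4 → ℂ), Module.finrank ℂ W = 2 ∧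
    L = {x | Projectivization.submodule x ≤ W}

/-- The zero set in ℙ³ of a (homogeneous) polynomial. -/
def zeroSet (f : MvPolynomial (Fin 4) ℂ) : Set P3 :=
  {x | ∀ v ∈ Projectivization.submodule x, eval v f = 0}

/-- A Zariski-closed algebraic subset of ℙ³: a common zero locus of homogeneous
polynomials. -/
def IsAlgClosedSet (X : Set P3) : Prop :=
  ∃ S : Set (MvPolynomial (Fin 4) ℂ), (∀ f ∈ S, ∃ d, f.IsHomogeneous d) ∧
    X = ⋂ f ∈ S, zeroSet f

/-- A set is irreducible (in the Zariski sense) if it is nonempty and is not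
covered by two algebraic closed sets unless it lies in one of them. -/
def IsIrredSet (X : Set P3) : Prop :=
  X.Nonempty ∧ ∀ Y Z : Set P3, IsAlgClosedSet Y → IsAlgClosedSet Z →
    X ⊆ Y ∪ Z → (X ⊆ Y ∨ X ⊆ Z)

/-- `C` is a curve of degree `d` in the plane `P`: cut out on `P` by a
homogeneous polynomial of degree `d > 0`. -/
def IsCurveOfDeg (P C : Set P3) (d : ℕ) : Prop :=
  0 < d ∧ ∃ f : MvPolynomial (Fin 4) ℂ, f.IsHomogeneous d ∧ C = zeroSet f ∩ P

/-- `C` is an irreducible curve in the plane `P`. -/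
def IsIrrCurve (P C : Set P3) : Prop :=
  (∃ d, IsCurveOfDeg P C d) ∧ IsIrredSet C

namespace Polynomial.ConeAux
end Polynomial.ConeAux
open Polynomial.ConeAux

section
open MvPolynomial

theorem coeff_aeval_lam {σ : Type*} {k Q : Type*} [CommRing k] [CommRing Q] [Algebra k Q]
    (x : σ → Q) (f : MvPolynomial σ k) (m : ℕ) :
    (aeval (fun i => (Polynomial.X * Polynomial.C (x i) : Polynomial Q)) f).coeff m
      = aeval x (homogeneousComponent m f) := by
  classical
  induction f using MvPolynomial.induction_on' with
  | monomial s a =>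
    rw [homogeneousComponent_of_mem (n := s.degree) (isHomogeneous_monomial _ rfl),
      aeval_monomial]
    have : (s.prod fun i e => (Polynomial.X * Polynomial.C (x i) : Polynomial Q) ^ e) =
        Polynomial.C (s.prod fun i e => x i ^ e) * Polynomial.X ^ s.degree := by
      simp only [Finsupp.prod, mul_pow, Finset.prod_mul_distrib, Finset.prod_pow_eq_pow_sum,
        map_prod, map_pow]
      rw [Finsupp.degree_apply]
      ring
    rw [this, Polynomial.algebraMap_apply, ← mul_assoc, ← map_mul, Polynomial.coeff_C_mul_X_pow]
    split_ifs with h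
    · rw [aeval_monomial]
    · simp
  | add p q hp hq => rw [map_add, Polynomial.coeff_add, hp, hq, map_add, map_add]

theorem isHomogeneous_of_lam {σ : Type*} (f : MvPolynomial σ ℂ) (a : ℕ)
   (h : ∀ m, m ≠ a → (aeval (fun i => (Polynomial.X * Polynomial.C (X i) : Polynomial (MvPolynomial σ ℂ))) f).coeff m = 0) : f.IsHomogeneous a := by
  simp only [coeff_aeval_lam, aeval_X_left, AlgHom.id_apply] at h
  rw [← sum_homogeneousComponent f]
  apply IsHomogeneous.sum
  intro i hi
  by_cases hia : i = a
  · subst hia; exact homogeneousComponent_isHomogeneous _ _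
  · rw [h i hia]; exact isHomogeneous_zero _ _ _

theorem homog_factor {σ : Type*} (f g : MvPolynomial σ ℂ) (n : ℕ) (h : (f * g).IsHomogeneous n)
   (h0 : f * g ≠ 0) : ∃ a b, f.IsHomogeneous a ∧ g.IsHomogeneous b ∧ a + b = n := by
  set ψ : MvPolynomial σ ℂ →ₐ[ℂ] Polynomial (MvPolynomial σ ℂ) :=
    aeval (fun i => (Polynomial.X * Polynomial.C (X i) : Polynomial (MvPolynomial σ ℂ))) with hψ
  have hc : ∀ p m, (ψ p).coeff m = homogeneousComponent m p := by
    intro p m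
    rw [hψ, coeff_aeval_lam]; simp
  have hne : ∀ p, p ≠ 0 → ψ p ≠ 0 := by
    intro p hp h
    apply hp
    rw [← sum_homogeneousComponent p]
    exact Finset.sum_eq_zero fun i _ => by rw [← hc, h]; simp
  have hf := left_ne_zero_of_mul h0
  have hg := right_ne_zero_of_mul h0
  have hm : ψ f * ψ g = Polynomial.monomial n (f * g) := by
    rw [← map_mul]
    ext1 m
    rw [hc, homogeneousComponent_of_mem h, Polynomial.coeff_monomial]
    simp only [eq_comm]
  have h1 := Polynomial.natDegree_mul (hne f hf) (hne g hg)
  have h2 := Polynomial.natTrailingDegree_mul (hne f hf) (hne g hg)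
  rw [hm, Polynomial.natDegree_monomial_eq _ h0] at h1
  rw [hm, Polynomial.natTrailingDegree_monomial h0] at h2
  have h3 := Polynomial.natTrailingDegree_le_natDegree (ψ f)
  have h4 := Polynomial.natTrailingDegree_le_natDegree (ψ g)
  have key : ∀ p, (ψ p).natTrailingDegree = (ψ p).natDegree → p.IsHomogeneous (ψ p).natDegree := by
    intro p hp
    apply isHomogeneous_of_lam
    intro m hm
    rcases lt_or_gt_of_ne hm with h | h
    · exact Polynomial.coeff_eq_zero_of_lt_natTrailingDegree (hp ▸ h)
    · exact Polynomial.coeff_eq_zero_of_natDegree_lt h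
  exact ⟨_, _, key f (by omega), key g (by omega), by omega⟩
end

section
open MvPolynomial

theorem bez3 (g h : MvPolynomial (Fin 3) ℂ) (a b : ℕ) (ha : 0 < a) (hb : 0 < b)
    (hg : g.IsHomogeneous a) (hh : h.IsHomogeneous b) :
    ∃ y : Fin 3 → ℂ, y ≠ 0 ∧ eval y g = 0 ∧ eval y h = 0 := by
  classical
  by_contra hcon
  push Not at hcon
  let φ : ℕ → (MvPolynomial (Fin 3) ℂ →ₐ[ℂ] MvPolynomial (Fin 3) ℂ) := fun k =>
    aeval (fun i : Fin 3 => if (i : ℕ) < k then 0 else X i)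
  let I : ℕ → Ideal (MvPolynomial (Fin 3) ℂ) := fun k => RingHom.ker (φ k)
  have hI : ∀ k, (I k).IsPrime := fun k => RingHom.ker_isPrime _
  have hcomp : ∀ k p, φ (k+1) (φ k p) = φ (k+1) p := by
    intro k p
    have : (φ (k+1)).comp (φ k) = φ (k+1) := by
      ext i : 1
      simp only [φ, AlgHom.comp_apply, aeval_X]
      by_cases h1 : (i : ℕ) < k
      · simp [h1, h1.trans (Nat.lt_succ_self k)]
      · simp [h1]
    exact DFunLike.congr_fun this p
  have hlt : ∀ k, k < 3 → I k < I (k+1) := by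
    intro k hk
    refine lt_of_le_of_ne ?_ ?_
    · intro p hp
      rw [RingHom.mem_ker] at hp ⊢
      change φ (k+1) p = 0
      rw [← hcomp k p, show φ k p = 0 from hp, map_zero]
    · intro he
      have h1 : (X ⟨k, hk⟩ : MvPolynomial (Fin 3) ℂ) ∈ I (k+1) := by
        rw [RingHom.mem_ker]; change φ (k+1) _ = 0; simp [φ]
      rw [← he, RingHom.mem_ker] at h1
      change φ k _ = 0 at h1
      simp [φ] at h1
  have hht : ∀ k : ℕ, k ≤ 3 → (k : ℕ∞) ≤ (I k).height := by
    intro k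
    induction k with
    | zero => simp
    | succ k ih =>
      intro hk
      have := Ideal.height_add_one_le_of_lt_of_isPrime (hlt k (by omega))
      push_cast
      exact (add_le_add_left (ih (by omega)) 1).trans this
  have h3 := hht 3 le_rfl
  have hrad : (Ideal.span {g, h}).radical = I 3 := by
    rw [← MvPolynomial.vanishingIdeal_zeroLocus_eq_radical (K := ℂ)]
    have hz : ∀ (k : ℕ) (p : MvPolynomial (Fin 3) ℂ), 0 < k → p.IsHomogeneous k →
        eval 0 p = 0 := by
      intro k p hk hp
      rw [show eval 0 p = constantCoeff p from by rw [eval_zero]]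
      exact hp.coeff_eq_zero (by simpa using hk.ne)
    have : zeroLocus ℂ (Ideal.span {g, h}) = {0} := by
      rw [zeroLocus_span]
      ext y
      simp only [Set.mem_insert_iff, Set.mem_singleton_iff, forall_eq_or_imp, forall_eq,
        Set.mem_ofPred_eq, MvPolynomial.aeval_eq_eval]
      constructor
      · rintro ⟨h1, h2⟩
        by_contra hy
        exact hcon y hy h1 h2
      · rintro rfl
        exact ⟨hz a g ha hg, hz b h hb hh⟩
    rw [this]
    ext p
    rw [mem_vanishingIdeal_iff, RingHom.mem_ker]
    have : φ 3 p = C (eval 0 p) := by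
      have h2 : φ 3 = (Algebra.ofId ℂ (MvPolynomial (Fin 3) ℂ)).comp (aeval (0 : Fin 3 → ℂ)) := by
        ext i : 1
        simp [φ, Algebra.ofId_apply]
      rw [h2]
      simp [Algebra.ofId_apply, aeval_eq_eval]
    change _ ↔ φ 3 p = 0
    rw [this]
    simp [aeval_eq_eval]
  have hmin : I 3 ∈ (Ideal.span {g, h}).minimalPrimes := by
    rw [← Ideal.radical_minimalPrimes, hrad]
    have := hI 3
    rw [Ideal.minimalPrimes_eq_subsingleton_self]
    simp
  have := Ideal.height_le_card_of_mem_minimalPrimes_span_finset (s := {g, h}) (p := I 3) (by simpa using hmin)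
  have h4 := h3.trans this
  have h5 : ({g, h} : Finset (MvPolynomial (Fin 3) ℂ)).card ≤ 2 := Finset.card_le_two
  have : (3 : ℕ) ≤ ({g, h} : Finset (MvPolynomial (Fin 3) ℂ)).card := by exact_mod_cast h4
  omega
end

section
open MvPolynomial

noncomputable def restr {m : ℕ} (e : Fin m → Fin 4 → ℂ) :
    MvPolynomial (Fin 4) ℂ →ₐ[ℂ] MvPolynomial (Fin m) ℂ :=
  aeval (fun i => ∑ j, C (e j i) * X j)

theorem restr_homog {m : ℕ} (e : Fin m → Fin 4 → ℂ) (f : MvPolynomial (Fin 4) ℂ) (d : ℕ)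
    (hf : f.IsHomogeneous d) : (restr e f).IsHomogeneous d := by
  have := hf.aeval (fun i => ∑ j, C (e j i) * X j : Fin 4 → MvPolynomial (Fin m) ℂ) (n := 1)
    (fun i => IsHomogeneous.sum _ _ _ fun j _ => by
      simpa using (isHomogeneous_C_mul_X (e j i) j))
  simpa [restr] using this

theorem aeval_restr {m : ℕ} {Q : Type*} [CommRing Q] [Algebra ℂ Q] (e : Fin m → Fin 4 → ℂ)
    (f : MvPolynomial (Fin 4) ℂ) (y : Fin m → Q) :
    aeval y (restr e f) = aeval (fun i => ∑ j, algebraMap ℂ Q (e j i) * y j) f := by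
  rw [restr, ← AlgHom.comp_apply, comp_aeval]
  simp [← algebraMap_eq]

theorem eval_restr {m : ℕ} (e : Fin m → Fin 4 → ℂ) (f : MvPolynomial (Fin 4) ℂ) (y : Fin m → ℂ) :
    eval y (restr e f) = eval (∑ j, y j • e j) f := by
  have := aeval_restr e f y
  rw [aeval_eq_eval] at this
  rw [this, aeval_eq_eval]
  congr 2
  ext i
  simp [mul_comm]

theorem homog_zero_unit {σ : Type*} (f : MvPolynomial σ ℂ) (hf : f.IsHomogeneous 0) (h0 : f ≠ 0) : IsUnit f := by
  rw [← totalDegree_zero_iff_isHomogeneous, totalDegree_eq_zero_iff_eq_C] at hf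
  rw [hf] at h0 ⊢
  refine IsUnit.map C (Ne.isUnit ?_)
  intro h
  rw [h] at h0
  simp at h0

theorem homog_pos_not_unit {σ : Type*} (f : MvPolynomial σ ℂ) (n : ℕ) (hn : 0 < n) (hf : f.IsHomogeneous n) : ¬ IsUnit f := by
  intro h
  have h0 : f ≠ 0 := h.ne_zero
  have h1 := hf.totalDegree h0
  have h2 := MvPolynomial.isUnit_iff_totalDegree_of_isReduced.1 h
  omega

theorem irred_of_smooth (n : ℕ) (hn : 0 < n) (F : MvPolynomial (Fin 4) ℂ) (hF : F.IsHomogeneous n)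
    (hsmooth : ∀ v : Fin 4 → ℂ, v ≠ 0 → eval v F = 0 →
      ∃ i : Fin 4, eval v (pderiv i F) ≠ 0) : Irreducible F := by
  have h0 : F ≠ 0 := by
    rintro rfl
    obtain ⟨i, hi⟩ := hsmooth 1 one_ne_zero (by simp)
    simp at hi
  refine ⟨homog_pos_not_unit F n hn hF, ?_⟩
  rintro G H rfl
  by_contra hcon
  push Not at hcon
  obtain ⟨a, b, hG, hH, hab⟩ := homog_factor G H n hF h0
  have ha : 0 < a := by
    rcases Nat.eq_zero_or_pos a with rfl | h
    · exact absurd (homog_zero_unit G hG (left_ne_zero_of_mul h0)) hcon.1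
    · exact h
  have hb : 0 < b := by
    rcases Nat.eq_zero_or_pos b with rfl | h
    · exact absurd (homog_zero_unit H hH (right_ne_zero_of_mul h0)) hcon.2
    · exact h
  let e : Fin 3 → Fin 4 → ℂ := fun j => Pi.single j.castSucc 1
  obtain ⟨y, hy, h1, h2⟩ := bez3 (restr e G) (restr e H) a b ha hb (restr_homog _ _ _ hG) (restr_homog _ _ _ hH)
  rw [eval_restr] at h1 h2
  set v := ∑ j, y j • e j
  have hv : v ≠ 0 := by
    intro hv
    apply hy
    ext j
    have : v j.castSucc = 0 := by rw [hv]; rfl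
    simpa [v, e, Finset.sum_apply, Pi.single_apply] using this
  obtain ⟨i, hi⟩ := hsmooth v hv (by simp [h1])
  apply hi
  simp [h1, h2]
end

section
open scoped Polynomial
namespace Polynomial.ConeAux
def ExpRel {O : Type*} [CommRing O] [Algebra ℂ O] (π x : O) (a : PowerSeries ℂ) : Prop :=
  ∀ n : ℕ, ∃ p : Polynomial ℂ, (PowerSeries.X ^ n ∣ a - (p : PowerSeries ℂ)) ∧
    π ^ n ∣ x - Polynomial.aeval π p

theorem ExpRel.add {O : Type*} [CommRing O] [Algebra ℂ O] {π x y : O} {a b : PowerSeries ℂ}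
    (h1 : ExpRel π x a) (h2 : ExpRel π y b) : ExpRel π (x + y) (a + b) := by
  intro n
  obtain ⟨p, hp1, hp2⟩ := h1 n
  obtain ⟨q, hq1, hq2⟩ := h2 n
  refine ⟨p + q, ?_, ?_⟩
  · rw [Polynomial.coe_add, show a + b - (p + q : PowerSeries ℂ) = (a - p) + (b - q) by ring]
    exact dvd_add hp1 hq1
  · rw [map_add, show x + y - (Polynomial.aeval π p + Polynomial.aeval π q) = (x - Polynomial.aeval π p) + (y - Polynomial.aeval π q) by ring]
    exact dvd_add hp2 hq2

theorem ExpRel.mul {O : Type*} [CommRing O] [Algebra ℂ O] {π x y : O} {a b : PowerSeries ℂ}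
    (h1 : ExpRel π x a) (h2 : ExpRel π y b) : ExpRel π (x * y) (a * b) := by
  intro n
  obtain ⟨p, hp1, hp2⟩ := h1 n
  obtain ⟨q, hq1, hq2⟩ := h2 n
  refine ⟨p * q, ?_, ?_⟩
  · rw [Polynomial.coe_mul, show a * b - (p * q : PowerSeries ℂ) = (a - p) * b + p * (b - q) by ring]
    exact dvd_add (hp1.mul_right _) (hq1.mul_left _)
  · rw [map_mul, show x * y - (Polynomial.aeval π p * Polynomial.aeval π q) = (x - Polynomial.aeval π p) * y + Polynomial.aeval π p * (y - Polynomial.aeval π q) by ring]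
    exact dvd_add (hp2.mul_right _) (hq2.mul_left _)

theorem ExpRel.const {O : Type*} [CommRing O] [Algebra ℂ O] (π : O) (c : ℂ) :
    ExpRel π (algebraMap ℂ O c) (PowerSeries.C c) := by
  intro n
  refine ⟨Polynomial.C c, ?_, ?_⟩ <;> simp

theorem ExpRel.eq_zero {O : Type*} [CommRing O] [IsDomain O] [Algebra ℂ O] {π : O} (hπ0 : π ≠ 0)
    (hπ : ¬ IsUnit π) {a : PowerSeries ℂ} (h1 : ExpRel π 0 a) : a = 0 := by
  ext m
  obtain ⟨p, hp1, hp2⟩ := h1 (m + 1)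
  have key : Polynomial.X ^ (m + 1) ∣ p := by
    by_cases hp : p = 0
    · simp [hp]
    obtain ⟨q, hq, hq'⟩ := Polynomial.exists_eq_pow_rootMultiplicity_mul_and_not_dvd p hp 0
    set k := p.rootMultiplicity 0
    rw [map_zero, sub_zero] at hq hq'
    by_cases hk : m + 1 ≤ k
    · rw [hq]; exact (pow_dvd_pow _ hk).mul_right _
    exfalso
    push Not at hk
    rw [zero_sub, dvd_neg, hq, map_mul, map_pow, Polynomial.aeval_X] at hp2
    have h3 : π ∣ Polynomial.aeval π q := by
      rw [show m + 1 = k + (m + 1 - k - 1) + 1 by omega, pow_succ, pow_add] at hp2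
      have := (dvd_trans (by exact ⟨π ^ (m + 1 - k - 1), by ring⟩) hp2 : π ^ k * π ∣ π ^ k * Polynomial.aeval π q)
      exact (mul_dvd_mul_iff_left (pow_ne_zero _ hπ0)).1 this
    rw [Polynomial.X_dvd_iff] at hq'
    have h4 : π ∣ Polynomial.aeval π q - algebraMap ℂ O (q.coeff 0) := by
      obtain ⟨r, hr⟩ := Polynomial.X_dvd_sub_C (p := q)
      have := congrArg (Polynomial.aeval π) hr
      rw [map_sub, Polynomial.aeval_C, map_mul, Polynomial.aeval_X] at this
      exact ⟨_, this⟩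
    have h5 : π ∣ algebraMap ℂ O (q.coeff 0) := (dvd_sub_right h3).1 h4
    exact hπ (isUnit_of_dvd_unit h5 ((Ne.isUnit hq').map _))
  obtain ⟨r, hr⟩ := key
  have : PowerSeries.X ^ (m + 1) ∣ a := by
    have h2 : (PowerSeries.X ^ (m+1) : PowerSeries ℂ) ∣ p := ⟨r, by rw [hr]; simp⟩
    simpa using dvd_add hp1 h2
  rw [PowerSeries.X_pow_dvd_iff] at this
  simpa using this m (Nat.lt_succ_self m)

theorem dvr_expand {O : Type*} [CommRing O] [IsDomain O] [IsDiscreteValuationRing O] [Algebra ℂ O]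
    (hs : ∀ x : O, ∃ c : ℂ, x - algebraMap ℂ O c ∈ IsLocalRing.maximalIdeal O) :
    ∃ ψ : O →ₐ[ℂ] PowerSeries ℂ, Function.Injective ψ ∧
      ∀ x ∈ IsLocalRing.maximalIdeal O, PowerSeries.constantCoeff (ψ x) = 0 := by
  obtain ⟨π, hπ⟩ := IsDiscreteValuationRing.exists_irreducible O
  have hmax := hπ.maximalIdeal_eq
  have hs' : ∀ x : O, ∃ cy : ℂ × O, x = algebraMap ℂ O cy.1 + π * cy.2 := by
    intro x
    obtain ⟨c, hc⟩ := hs x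
    rw [hmax, Ideal.mem_span_singleton] at hc
    obtain ⟨y, hy⟩ := hc
    exact ⟨(c, y), by rw [← hy]; ring⟩
  choose g hg using hs'
  let σ : O → O := fun x => (g x).2
  let c : O → ℂ := fun x => (g x).1
  have hex : ∀ x, ExpRel π x (PowerSeries.mk fun k => c (σ^[k] x)) := by
    intro x n
    refine ⟨PowerSeries.trunc n (PowerSeries.mk fun k => c (σ^[k] x)), ?_, ?_⟩
    · rw [PowerSeries.X_pow_dvd_iff]
      intro m hm
      simp [PowerSeries.coeff_trunc, hm]
    · refine ⟨σ^[n] x, ?_⟩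
      induction n with
      | zero => simp
      | succ n ih =>
        rw [PowerSeries.trunc_succ, map_add, ← sub_sub, ih, Polynomial.aeval_monomial]
        have := hg (σ^[n] x)
        rw [Function.iterate_succ_apply']
        simp only [PowerSeries.coeff_mk]
        change σ^[n] x = algebraMap ℂ O (c (σ^[n] x)) + π * σ (σ^[n] x) at this
        linear_combination π ^ n * this
  have huniq : ∀ x a b, ExpRel π x a → ExpRel π x b → a = b := by
    intro x a b ha hb
    have h1 := (ha.add ((ExpRel.const π (-1)).mul hb)).add (ExpRel.const π 0)
    have h2 := ExpRel.eq_zero hπ.ne_zero hπ.not_isUnit (a := a - b) (by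
      convert h1 using 1
      · simp
      · simp; ring)
    exact sub_eq_zero.1 h2
  choose ψ hψ using fun x => (⟨_, hex x⟩ : ∃ a, ExpRel π x a)
  refine ⟨{ toFun := ψ, map_one' := ?_, map_mul' := ?_, map_zero' := ?_, map_add' := ?_, commutes' := ?_ }, ?_, ?_⟩
  · exact huniq 1 _ _ (hψ 1) (by simpa using ExpRel.const π 1)
  · exact fun x y => huniq _ _ _ (hψ _) ((hψ x).mul (hψ y))
  · exact huniq 0 _ _ (hψ 0) (by simpa using ExpRel.const π 0)
  · exact fun x y => huniq _ _ _ (hψ _) ((hψ x).add (hψ y))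
  · exact fun r => huniq _ _ _ (hψ _) (ExpRel.const π r)
  · rw [injective_iff_map_eq_zero]
    intro x hx
    change ψ x = 0 at hx
    have h1 := hψ x
    rw [hx] at h1
    have h2 : x ∈ (⨅ i : ℕ, IsLocalRing.maximalIdeal O ^ i) := by
      rw [Ideal.mem_iInf]
      intro n
      rw [hmax, Ideal.span_singleton_pow, Ideal.mem_span_singleton]
      obtain ⟨p, hp1, hp2⟩ := h1 n
      have h3 : Polynomial.X ^ n ∣ p := by
        rw [Polynomial.X_pow_dvd_iff]
        intro d hd
        rw [PowerSeries.X_pow_dvd_iff] at hp1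
        simpa using hp1 d hd
      obtain ⟨q, rfl⟩ := h3
      have h4 : π ^ n ∣ Polynomial.aeval π (Polynomial.X ^ n * q) := by simp
      simpa using dvd_add hp2 h4
    rwa [Ideal.iInf_pow_eq_bot_of_isLocalRing _ (IsLocalRing.maximalIdeal.isMaximal O).ne_top] at h2
  · intro x hx
    change PowerSeries.constantCoeff (ψ x) = 0
    rw [hmax, Ideal.mem_span_singleton] at hx
    obtain ⟨p, hp1, hp2⟩ := hψ x 1
    rw [pow_one] at hp1 hp2
    rw [PowerSeries.X_dvd_iff] at hp1
    have h4 : π ∣ Polynomial.aeval π p - algebraMap ℂ O (p.coeff 0) := by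
      obtain ⟨r, hr⟩ := Polynomial.X_dvd_sub_C (p := p)
      have := congrArg (Polynomial.aeval π) hr
      rw [map_sub, Polynomial.aeval_C, map_mul, Polynomial.aeval_X] at this
      exact ⟨_, this⟩
    have h5 : π ∣ algebraMap ℂ O (p.coeff 0) := by
      have := (dvd_sub_right hx).1 hp2
      exact (dvd_sub_right this).1 h4
    by_cases h0 : p.coeff 0 = 0
    · simpa [h0, sub_eq_zero] using hp1
    · exact absurd (isUnit_of_dvd_unit h5 ((Ne.isUnit h0).map _)) hπ.not_isUnit
end Polynomial.ConeAux
end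

section
open scoped Polynomial
namespace Polynomial.ConeAux
theorem ded_expand {A : Type} [CommRing A] [IsDomain A] [IsDedekindDomain A] [Algebra ℂ A]
    [Algebra (Polynomial ℂ) A] [IsScalarTower ℂ (Polynomial ℂ) A]
    [Algebra.IsIntegral (Polynomial ℂ) A] (M : Ideal A) [M.IsMaximal] (hM0 : M ≠ ⊥)
    (hXM : algebraMap (Polynomial ℂ) A X ∈ M) :
    ∃ ψ : A →ₐ[ℂ] PowerSeries ℂ, Function.Injective ψ ∧
      ∀ x ∈ M, PowerSeries.constantCoeff (ψ x) = 0 := by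
  let O := Localization.AtPrime M
  have : IsDiscreteValuationRing O :=
    IsLocalization.AtPrime.isDiscreteValuationRing_of_dedekind_domain A hM0 O
  have hres : ∀ x : A, ∃ c : ℂ, x - algebraMap ℂ A c ∈ M := by
    letI : Field (A ⧸ M) := Ideal.Quotient.field M
    have hint : Algebra.IsIntegral ℂ (A ⧸ M) := by
      constructor
      intro y
      obtain ⟨x, rfl⟩ := Ideal.Quotient.mk_surjective y
      obtain ⟨p, hp, hpx⟩ := Algebra.IsIntegral.isIntegral (R := Polynomial ℂ) x
      refine ⟨p.map (Polynomial.evalRingHom 0), hp.map _, ?_⟩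
      have h1 : (algebraMap ℂ (A ⧸ M)).comp (Polynomial.evalRingHom 0) =
          (Ideal.Quotient.mk M).comp (algebraMap (Polynomial ℂ) A) := by
        apply Polynomial.ringHom_ext
        · intro a
          simp only [RingHom.comp_apply, coe_evalRingHom, eval_C]
          rw [← Polynomial.algebraMap_eq, ← IsScalarTower.algebraMap_apply]
          rfl
        · simp only [RingHom.comp_apply, coe_evalRingHom, eval_X, map_zero]
          exact (Ideal.Quotient.eq_zero_iff_mem.2 hXM).symm
      rw [Polynomial.eval₂_map, h1, ← Polynomial.hom_eval₂, hpx, map_zero]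
    intro x
    obtain ⟨c, hc⟩ := (IsAlgClosed.algebraMap_bijective_of_isIntegral (k := ℂ) (K := A ⧸ M)).2
      (Ideal.Quotient.mk M x)
    refine ⟨c, ?_⟩
    rw [← Ideal.Quotient.eq_zero_iff_mem, map_sub, sub_eq_zero, ← hc]
    rfl
  obtain ⟨ψ, hψ, hψ'⟩ := dvr_expand (O := O) (by
    intro z
    obtain ⟨y, hy⟩ := (IsLocalization.AtPrime.equivQuotMaximalIdeal M O).surjective (Ideal.Quotient.mk _ z)
    obtain ⟨x, rfl⟩ := Ideal.Quotient.mk_surjective y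
    rw [IsLocalization.AtPrime.equivQuotMaximalIdeal_apply_mk] at hy
    obtain ⟨c, hc⟩ := hres x
    refine ⟨c, ?_⟩
    have h1 : algebraMap A O x - z ∈ IsLocalRing.maximalIdeal O := Ideal.Quotient.eq.1 hy
    have h2 : algebraMap A O (x - algebraMap ℂ A c) ∈ IsLocalRing.maximalIdeal O :=
      (IsLocalization.AtPrime.to_map_mem_maximal_iff O M _).2 hc
    rw [map_sub, ← IsScalarTower.algebraMap_apply] at h2
    have h3 := sub_mem h2 h1
    convert h3 using 1
    ring)
  refine ⟨ψ.comp (IsScalarTower.toAlgHom ℂ A O), ?_, ?_⟩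
  · rw [AlgHom.coe_comp]
    exact hψ.comp (IsLocalization.injective O M.primeCompl_le_nonZeroDivisors)
  · intro x hx
    exact hψ' _ ((IsLocalization.AtPrime.to_map_mem_maximal_iff O M _).2 hx)

theorem exists_arc (m : Polynomial (Polynomial ℂ)) (hm : m.Monic) (h0 : (m.eval 0).eval 0 = 0) :
    ∃ u v : PowerSeries ℂ, PowerSeries.constantCoeff u = 0 ∧ PowerSeries.constantCoeff v = 0 ∧
      u ≠ 0 ∧ m.eval₂ (Polynomial.aeval u : Polynomial ℂ →ₐ[ℂ] PowerSeries ℂ).toRingHom v = 0 := by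
  classical
  let K := FractionRing (Polynomial ℂ)
  let mK := m.map (algebraMap (Polynomial ℂ) K)
  let L := mK.SplittingField
  let A := integralClosure (Polynomial ℂ) L
  have hded : IsDedekindDomain A := integralClosure.isDedekindDomain (Polynomial ℂ) K L
  have hint : Algebra.IsIntegral (Polynomial ℂ) A := inferInstance
  have hinjL : Function.Injective (algebraMap (Polynomial ℂ) L) := by
    rw [IsScalarTower.algebraMap_eq (Polynomial ℂ) K L]
    exact (algebraMap K L).injective.comp (IsFractionRing.injective _ _)
  have hinj : Function.Injective (algebraMap (Polynomial ℂ) A) := by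
    intro a b hab
    exact hinjL (congrArg (algebraMap A L) hab)
  have hXp : (Ideal.span {(X : Polynomial ℂ)}).IsMaximal :=
    PrincipalIdealRing.isMaximal_of_irreducible Polynomial.irreducible_X
  obtain ⟨M, hMmax, hM⟩ := Ideal.exists_ideal_over_maximal_of_isIntegral (S := A)
    (Ideal.span {(X : Polynomial ℂ)}) (by
      rw [(RingHom.injective_iff_ker_eq_bot _).1 hinj]; exact bot_le)
  have hXM : algebraMap (Polynomial ℂ) A X ∈ M := by
    have : (X : Polynomial ℂ) ∈ M.comap (algebraMap (Polynomial ℂ) A) := by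
      rw [hM]; exact Ideal.mem_span_singleton_self _
    exact this
  have hM0 : M ≠ ⊥ := by
    rintro rfl
    rw [Ideal.mem_bot] at hXM
    exact Polynomial.X_ne_zero (hinj (by rw [hXM, map_zero]))
  -- root
  have hsplit : (mK.map (algebraMap K L)).Splits := SplittingField.splits mK
  have hmL : mK.map (algebraMap K L) = m.map (algebraMap (Polynomial ℂ) L) := by
    rw [Polynomial.map_map, ← IsScalarTower.algebraMap_eq]
  have hmon : (m.map (algebraMap (Polynomial ℂ) L)).Monic := hm.map _
  rw [hmL] at hsplit
  obtain ⟨w, hwM, hw⟩ : ∃ w : A, w ∈ M ∧ m.eval₂ (algebraMap (Polynomial ℂ) A) w = 0 := by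
    have hA : ∀ x ∈ (m.map (algebraMap (Polynomial ℂ) L)).roots, ∃ y : A, algebraMap A L y = x := by
      intro x hx
      rw [Polynomial.mem_roots hmon.ne_zero, IsRoot.def, eval_map] at hx
      exact ⟨⟨x, m, hm, hx⟩, rfl⟩
    obtain ⟨s, hs⟩ : ∃ s : Multiset A, s.map (algebraMap A L) =
        (m.map (algebraMap (Polynomial ℂ) L)).roots := by
      choose! φ hφ using hA
      refine ⟨(m.map (algebraMap (Polynomial ℂ) L)).roots.map φ, ?_⟩
      rw [Multiset.map_map]
      conv_rhs => rw [← Multiset.map_id (m.map (algebraMap (Polynomial ℂ) L)).roots]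
      exact Multiset.map_congr rfl fun x hx => hφ x hx
    have hAL : Function.Injective (algebraMap A L) := Subtype.val_injective
    have hprod : m.map (algebraMap (Polynomial ℂ) A) = (s.map fun y => X - C y).prod := by
      apply Polynomial.map_injective _ hAL
      rw [Polynomial.map_map, ← IsScalarTower.algebraMap_eq, hsplit.eq_prod_roots_of_monic hmon,
        Polynomial.map_multiset_prod, ← hs, Multiset.map_map, Multiset.map_map]
      simp
      rfl
    have h1 : algebraMap (Polynomial ℂ) A (m.eval 0) ∈ M := by
      obtain ⟨q, hq⟩ := (Polynomial.X_dvd_iff (f := m.eval 0)).2 (by rw [Polynomial.coeff_zero_eq_eval_zero]; exact h0)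
      rw [hq, map_mul]
      exact M.mul_mem_right _ hXM
    have h2 : algebraMap (Polynomial ℂ) A (m.eval 0) = (s.map fun y => -y).prod := by
      have := congrArg (Polynomial.eval 0) hprod
      rw [Polynomial.eval_multiset_prod, Multiset.map_map] at this
      rw [← map_zero (algebraMap (Polynomial ℂ) A), Polynomial.eval_map_apply] at this
      rw [this]
      simp
    rw [h2, hMmax.isPrime.multiset_prod_mem_iff_exists_mem] at h1
    obtain ⟨w', hw', hwM⟩ := h1
    obtain ⟨w, hws, rfl⟩ := Multiset.mem_map.1 hw'
    refine ⟨w, by simpa using hwM, ?_⟩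
    rw [← Polynomial.eval_map, hprod, Polynomial.eval_multiset_prod]
    apply Multiset.prod_eq_zero
    rw [Multiset.map_map, Multiset.mem_map]
    exact ⟨w, hws, by simp⟩
  letI : Algebra ℂ A := ((algebraMap (Polynomial ℂ) A).comp C).toAlgebra
  have : IsScalarTower ℂ (Polynomial ℂ) A := IsScalarTower.of_algebraMap_eq fun x => rfl
  obtain ⟨ψ, hψ, hψ'⟩ := ded_expand M hM0 hXM
  have he : (Polynomial.aeval (ψ (algebraMap (Polynomial ℂ) A X)) : Polynomial ℂ →ₐ[ℂ] PowerSeries ℂ).toRingHom =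
      ψ.toRingHom.comp (algebraMap (Polynomial ℂ) A) := by
    apply Polynomial.ringHom_ext
    · intro a
      change Polynomial.aeval _ (C a) = ψ (algebraMap (Polynomial ℂ) A (C a))
      rw [Polynomial.aeval_C]
      exact (ψ.commutes a).symm
    · change Polynomial.aeval _ X = ψ (algebraMap (Polynomial ℂ) A X)
      rw [Polynomial.aeval_X]
  refine ⟨ψ (algebraMap (Polynomial ℂ) A X), ψ w, hψ' _ hXM, hψ' _ hwM, ?_, ?_⟩
  · intro h
    rw [← map_zero ψ] at h
    have := hψ h
    exact Polynomial.X_ne_zero (hinj (by rw [this, map_zero]))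
  · rw [he]
    change m.eval₂ (ψ.toRingHom.comp (algebraMap (Polynomial ℂ) A)) (ψ.toRingHom w) = 0
    rw [← Polynomial.hom_eval₂, hw, map_zero]
end Polynomial.ConeAux
end

section
theorem minors {R : Type*} [CommRing R] [IsDomain R] {I : Type*} [Fintype I] [DecidableEq I]
    (x : I → PowerSeries R)
    (hx : ∀ a : I → R, (∑ i, PowerSeries.C (a i) * x i = 0) → a = 0) :
    ∃ h : R, h ≠ 0 ∧ ∀ φ : R →+* ℂ, φ h ≠ 0 → ∀ a : I → ℂ,
      ∑ i, PowerSeries.C (a i) * PowerSeries.map φ (x i) = 0 → a = 0 := by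
  classical
  let K := FractionRing R
  let c : ℕ → I → K := fun m i => algebraMap R K (PowerSeries.coeff m (x i))
  have hspan : Submodule.span K (Set.range c) = ⊤ := by
    by_contra hne
    obtain ⟨l, hl0, hl⟩ := Submodule.exists_le_ker_of_lt_top _ (lt_top_iff_ne_top.2 hne)
    apply hl0
    obtain ⟨b, hb⟩ := IsLocalization.exist_integer_multiples_of_finite (nonZeroDivisors R)
      (fun i => l (Pi.single i 1))
    choose a ha using hb
    have ha0 : a = 0 := by
      apply hx
      ext m
      have h1 : l (c m) = 0 := hl (Submodule.subset_span ⟨m, rfl⟩)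
      rw [map_sum]
      simp only [PowerSeries.coeff_C_mul, map_zero]
      apply IsFractionRing.injective R K
      rw [map_sum, map_zero]
      have h2 : c m = ∑ i, c m i • (Pi.single i 1 : I → K) := by
        ext j
        simp [Finset.sum_apply, Pi.single_apply]
      rw [h2, map_sum] at h1
      calc _ = ∑ i, (b : R) • l (c m i • (Pi.single i 1 : I → K)) := by
            refine Finset.sum_congr rfl fun i _ => ?_
            rw [map_mul, ha i, map_smul]
            change _ = (b : R) • (c m i * l (Pi.single i 1))
            rw [Algebra.smul_def, Algebra.smul_def]
            change _ * algebraMap R K _ = _ * (algebraMap R K _ * _)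
            ring
        _ = 0 := by rw [← Finset.smul_sum, h1, smul_zero]
    ext i
    have := ha i
    rw [ha0] at this
    simp only [Pi.zero_apply, map_zero] at this
    have h3 := this.symm
    rw [Algebra.smul_def, mul_eq_zero] at h3
    rcases h3 with h3 | h3
    · exact absurd h3 (by
        intro h4
        exact nonZeroDivisors.coe_ne_zero b ((FaithfulSMul.algebraMap_eq_zero_iff R K).1 h4))
    · simpa using h3
  -- choose basis
  obtain ⟨m, hm⟩ : ∃ m : I → ℕ, LinearIndependent K (fun j => c (m j)) := by
    obtain ⟨κ, a, ha, hsp, hli⟩ := exists_linearIndependent' K c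
    rw [hspan] at hsp
    let bas := Module.Basis.mk hli hsp.ge
    have : Finite κ := Module.Finite.finite_basis bas
    have : Fintype κ := Fintype.ofFinite κ
    have hcard : Fintype.card κ = Fintype.card I := by
      rw [← Module.finrank_eq_card_basis bas, Module.finrank_fintype_fun_eq_card]
    let e := (Fintype.equivOfCardEq hcard)
    refine ⟨fun j => a (e.symm j), ?_⟩
    exact hli.comp e.symm e.symm.injective
  let M : Matrix I I R := Matrix.of fun j i => PowerSeries.coeff (m j) (x i)
  refine ⟨M.det, ?_, ?_⟩
  · intro h0
    have : (M.map (algebraMap R K)).det = 0 := by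
      have := RingHom.map_det (algebraMap R K) M
      rw [RingHom.mapMatrix_apply] at this
      rw [← this, h0, map_zero]
    have h2 := (Matrix.linearIndependent_rows_iff_isUnit (A := M.map (algebraMap R K))).1 hm
    rw [Matrix.isUnit_iff_isUnit_det, this] at h2
    exact not_isUnit_zero h2
  · intro φ hφ a ha
    have hdet : (M.map φ).det ≠ 0 := by
      have := RingHom.map_det φ M
      rw [RingHom.mapMatrix_apply] at this
      rwa [← this]
    apply Matrix.eq_zero_of_mulVec_eq_zero hdet
    ext j
    have := congrArg (PowerSeries.coeff (m j)) ha
    rw [map_sum] at this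
    simp only [PowerSeries.coeff_C_mul, PowerSeries.coeff_map, map_zero] at this
    simp only [Matrix.mulVec, dotProduct, Matrix.map_apply, M, Matrix.of_apply, Pi.zero_apply]
    rw [← this]
    exact Finset.sum_congr rfl fun i _ => mul_comm _ _
end

section
open scoped Polynomial
namespace Polynomial.ConeAux
section

theorem bez_elim {A : Type*} [CommRing A] [IsDomain A] [IsIntegrallyClosed A] (f g : A[X])
    (hf : f.Monic) (hirr : Irreducible f) (hg : ¬ f ∣ g) :
    ∃ (a b : A[X]) (D : A), D ≠ 0 ∧ a * f + b * g = C D := by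
  let K := FractionRing A
  have hinj : Function.Injective (algebraMap A K) := IsFractionRing.injective A K
  have h1 : Irreducible (f.map (algebraMap A K)) :=
    (Monic.irreducible_iff_irreducible_map_fraction_map hf).1 hirr
  have h2 : ¬ f.map (algebraMap A K) ∣ g.map (algebraMap A K) := fun h =>
    hg (Polynomial.map_dvd_map _ hinj hf |>.1 h)
  obtain ⟨a, b, hab⟩ := (EuclideanDomain.dvd_or_coprime _ _ h1).resolve_left h2
  obtain ⟨c, hc, hca⟩ := IsLocalization.integerNormalization_spec (nonZeroDivisors A) a
  obtain ⟨c', hc', hcb⟩ := IsLocalization.integerNormalization_spec (nonZeroDivisors A) b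
  set a' := IsLocalization.integerNormalization (nonZeroDivisors A) a
  set b' := IsLocalization.integerNormalization (nonZeroDivisors A) b
  refine ⟨C c' * a', C c * b', c * c', mul_ne_zero (nonZeroDivisors.ne_zero hc)
    (nonZeroDivisors.ne_zero hc'), ?_⟩
  apply Polynomial.map_injective _ hinj
  simp only [Polynomial.map_add, Polynomial.map_mul, map_C, hca, hcb]
  have e1 : ∀ (c : A) (p : K[X]), c • p = C (algebraMap A K c) * p := by
    intro c p
    ext i
    simp [Algebra.smul_def]
  rw [e1, e1]
  simp only [map_mul]
  linear_combination (C (algebraMap A K c) * C (algebraMap A K c')) * hab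

theorem hensel_root {R : Type*} [CommRing R] (G : Polynomial (PowerSeries R))
    (hlead : IsUnit G.leadingCoeff)
    (h0 : PowerSeries.constantCoeff (G.eval 0) = 0)
    (h1 : IsUnit (PowerSeries.constantCoeff (G.derivative.eval 0))) :
    ∃ t : PowerSeries R, PowerSeries.constantCoeff t = 0 ∧ G.eval t = 0 := by
  let I : Ideal (PowerSeries R) := Ideal.span {PowerSeries.X}
  have hI : ∀ a : PowerSeries R, a ∈ I ↔ PowerSeries.constantCoeff a = 0 := by
    intro a
    rw [Ideal.mem_span_singleton, PowerSeries.X_dvd_iff]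
  obtain ⟨w, hw⟩ := hlead
  let G' := C (↑w⁻¹ : PowerSeries R) * G
  have hmon : G'.Monic := by
    refine Polynomial.monic_C_mul_of_mul_leadingCoeff_eq_one ?_
    rw [← hw, Units.inv_mul]
  have H := HenselianRing.is_henselian (I := I) G' hmon 0
    (by rw [hI]; simp [G', h0])
    (by
      apply IsUnit.map
      rw [PowerSeries.isUnit_iff_constantCoeff]
      simp only [G', derivative_mul, derivative_C, zero_mul, zero_add, eval_mul, eval_C, map_mul]
      exact ((Units.isUnit _).map _).mul h1)
  obtain ⟨t, ht, ht'⟩ := H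
  refine ⟨t, by rwa [sub_zero, hI] at ht', ?_⟩
  rw [IsRoot.def, eval_mul, eval_C] at ht
  exact (Units.isUnit w⁻¹).mul_right_eq_zero.1 ht

theorem res_common_root {S : Type*} [CommRing S] [IsDomain S] (G P : S[X]) (n N : ℕ)
    (hG : G.natDegree ≤ n) (hGn : G.coeff n ≠ 0) (hP : P.natDegree ≤ N)
    (hres : resultant G P n N = 0) :
    ∃ t : AlgebraicClosure (FractionRing S), aeval t G = 0 ∧ aeval t P = 0 := by
  let K := FractionRing S
  have hinj : Function.Injective (algebraMap S K) := IsFractionRing.injective S K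
  have hGd : G.natDegree = n := le_antisymm hG (le_natDegree_of_ne_zero hGn)
  obtain ⟨k, rfl⟩ := Nat.exists_eq_add_of_le hP
  rw [resultant_add_right_deg _ _ _ _ _ le_rfl] at hres
  have h1 : resultant G P = 0 := by
    rw [hGd]
    exact (mul_eq_zero.1 hres).resolve_left (pow_ne_zero _ hGn)
  have h2 : resultant (G.map (algebraMap S K)) (P.map (algebraMap S K)) = 0 := by
    rw [natDegree_map_eq_of_injective hinj, natDegree_map_eq_of_injective hinj,
      resultant_map_map, h1, map_zero]
  rw [resultant_eq_zero_iff] at h2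
  have h3 := h2.2
  rw [Polynomial.isCoprime_iff_aeval_ne_zero_of_isAlgClosed K (AlgebraicClosure K)] at h3
  push Not at h3
  obtain ⟨t, h4, h5⟩ := h3
  refine ⟨t, ?_, ?_⟩
  · rwa [aeval_map_algebraMap] at h4
  · rwa [aeval_map_algebraMap] at h5
end
end Polynomial.ConeAux
end

section
section
open MvPolynomial

theorem homog_scale {σ : Type*} {Q : Type*} [CommRing Q] [Algebra ℂ Q]
    (f : MvPolynomial σ ℂ) (n : ℕ) (hf : f.IsHomogeneous n) (c : Q) (y : σ → Q) :
    aeval (fun i => c * y i) f = c ^ n * aeval y f := by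
  rw [aeval_def, aeval_def, eval₂_eq, eval₂_eq, Finset.mul_sum]
  refine Finset.sum_congr rfl fun m hm => ?_
  have h1 : ∑ i ∈ m.support, m i = n := by
    have := hf (mem_support_iff.1 hm)
    rw [← this, Finsupp.weight_apply, Finsupp.sum]
    simp
  simp_rw [mul_pow]
  rw [Finset.prod_mul_distrib, Finset.prod_pow_eq_pow_sum, h1]
  ring

theorem homog_scale_eval {σ : Type*} (f : MvPolynomial σ ℂ) (n : ℕ) (hf : f.IsHomogeneous n)
    (c : ℂ) (y : σ → ℂ) : eval (c • y) f = c ^ n * eval y f := by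
  have := homog_scale f n hf c y
  exact this

theorem aeval_fs {k : ℕ} {Q : Type*} [CommRing Q] [Algebra ℂ Q]
    (f : MvPolynomial (Fin (k+1)) ℂ) (a : Q) (b : Fin k → Q) :
    aeval (Fin.cons a b : Fin (k+1) → Q) f =
      Polynomial.eval₂ (aeval b : MvPolynomial (Fin k) ℂ →ₐ[ℂ] Q).toRingHom a (finSuccEquiv ℂ k f) := by
  have h : (aeval (Fin.cons a b : Fin (k+1) → Q) : MvPolynomial (Fin (k+1)) ℂ →ₐ[ℂ] Q).toRingHom =
    (Polynomial.eval₂RingHom (aeval b : MvPolynomial (Fin k) ℂ →ₐ[ℂ] Q).toRingHom a).comp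
      (finSuccEquiv ℂ k).toRingEquiv.toRingHom := by
    apply MvPolynomial.ringHom_ext
    · intro r
      simp [finSuccEquiv_apply]
    · intro i
      refine Fin.cases ?_ (fun j => ?_) i
      · simp [finSuccEquiv_apply]
      · simp [finSuccEquiv_apply]
  exact congrArg (fun φ => φ f) h

theorem fs_lead {k : ℕ} (g : MvPolynomial (Fin (k+1)) ℂ) (d : ℕ) (hg : g.IsHomogeneous d) :
    (finSuccEquiv ℂ k g).natDegree ≤ d ∧
      (finSuccEquiv ℂ k g).coeff d = C (eval (Fin.cons 1 0 : Fin (k+1) → ℂ) g) := by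
  have h1 : (finSuccEquiv ℂ k g).natDegree ≤ d := by
    rw [natDegree_finSuccEquiv]
    exact (degreeOf_le_totalDegree _ _).trans hg.totalDegree_le
  refine ⟨h1, ?_⟩
  have h2 := hg.finSuccEquiv_coeff_isHomogeneous d 0 (add_zero d)
  have h3 : (finSuccEquiv ℂ k g).coeff d = C (eval 0 ((finSuccEquiv ℂ k g).coeff d)) := by
    have := (totalDegree_eq_zero_iff_eq_C.1 (Nat.le_zero.1 h2.totalDegree_le))
    rw [this]; simp
  rw [h3]
  congr 1
  rw [eval_eq_eval_mv_eval', Polynomial.eval_eq_sum_range' (n := d+1)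
    (lt_of_le_of_lt (Polynomial.natDegree_map_le.trans h1) (Nat.lt_succ_self _)),
    Finset.sum_range_succ, Finset.sum_eq_zero]
  · simp
  · intro i hi
    have hi' := Finset.mem_range.1 hi
    have h4 := hg.finSuccEquiv_coeff_isHomogeneous i (d - i) (by omega)
    have h5 := homog_scale_eval _ _ h4 0 0
    rw [zero_pow (by omega), zero_mul, smul_zero] at h5
    rw [Polynomial.coeff_map, h5, zero_mul]

theorem ps_transc (u : PowerSeries ℂ) (hu : PowerSeries.constantCoeff u = 0) (hu0 : u ≠ 0)
    (p : Polynomial ℂ) (hp : Polynomial.aeval u p = 0) : p = 0 := by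
  by_contra h0
  obtain ⟨q, hq, hnd⟩ := Polynomial.exists_eq_pow_rootMultiplicity_mul_and_not_dvd p h0 0
  rw [hq, map_mul, map_pow] at hp
  simp only [map_zero, sub_zero, Polynomial.aeval_X] at hp
  have h1 := (mul_eq_zero.1 hp).resolve_left (pow_ne_zero _ hu0)
  apply hnd
  rw [map_zero, sub_zero, Polynomial.X_dvd_iff]
  have h2 := congrArg PowerSeries.constantCoeff h1
  rw [Polynomial.aeval_def, Polynomial.hom_eval₂, hu, map_zero] at h2
  rw [Polynomial.eval₂_at_zero] at h2
  simpa using h2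

theorem homog2_inj (u : PowerSeries ℂ) (hu : PowerSeries.constantCoeff u = 0) (hu0 : u ≠ 0)
    (g : MvPolynomial (Fin 2) ℂ) (m : ℕ) (hg : g.IsHomogeneous m)
    (h : aeval (![1, u] : Fin 2 → PowerSeries ℂ) g = 0) : g = 0 := by
  have h1 : (aeval (![1, Polynomial.X] : Fin 2 → Polynomial ℂ) g) = 0 := by
    apply ps_transc u hu hu0
    rw [← AlgHom.comp_apply, comp_aeval]
    convert h using 2
    ext i
    fin_cases i <;> simp
  have h2 : g * X 0 = 0 := by
    apply MvPolynomial.funext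
    intro y
    rw [map_mul, map_zero, eval_X]
    by_cases hy : y 0 = 0
    · rw [hy, mul_zero]
    · have h3 := congrArg (Polynomial.aeval (y 1 / y 0)) h1
      rw [← AlgHom.comp_apply, comp_aeval, map_zero] at h3
      have h4 := homog_scale_eval g m hg (y 0) (fun i => Polynomial.aeval (y 1 / y 0) ((![1, Polynomial.X] : Fin 2 → Polynomial ℂ) i))
      have h5 : eval (fun i => Polynomial.aeval (y 1 / y 0) ((![1, Polynomial.X] : Fin 2 → Polynomial ℂ) i)) g = 0 := h3
      rw [h5, mul_zero] at h4
      have h6 : (y 0) • (fun i => Polynomial.aeval (y 1 / y 0) ((![1, Polynomial.X] : Fin 2 → Polynomial ℂ) i)) = y := by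
        ext i
        fin_cases i
        · simp
        · simp; field_simp
      rw [h6] at h4
      rw [h4, zero_mul]
  exact (mul_eq_zero.1 h2).resolve_right (X_ne_zero 0)

theorem form2_inj (u : PowerSeries ℂ) (hu : PowerSeries.constantCoeff u = 0) (hu0 : u ≠ 0)
    (g : MvPolynomial (Fin 2) ℂ)
    (h : aeval (fun i => Polynomial.X * Polynomial.C ((![1, u] : Fin 2 → PowerSeries ℂ) i)) g = 0) :
    g = 0 := by
  rw [← sum_homogeneousComponent g]
  refine Finset.sum_eq_zero fun m _ => ?_
  apply homog2_inj u hu hu0 _ m (homogeneousComponent_isHomogeneous m g)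
  rw [← coeff_aeval_lam, h, Polynomial.coeff_zero]

structure Dat (n d : ℕ) (F : MvPolynomial (Fin 4) ℂ) (e : Fin 3 → Fin 4 → ℂ)
    (fh : MvPolynomial (Fin 3) ℂ) (u v : PowerSeries ℂ) : Prop where
  hn : 0 < n
  hd : 0 < d
  hF : F.IsHomogeneous n
  hFirr : Irreducible F
  hfh : fh.IsHomogeneous d
  hirr : Irreducible fh
  hlead : eval ![1, 0, 0] fh = 1
  hFe : eval (e 0) F ≠ 0
  hu : PowerSeries.constantCoeff u = 0
  hv : PowerSeries.constantCoeff v = 0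
  hu0 : u ≠ 0
  harc : aeval ![v, 1, u] fh = 0
  hq0 : eval (e 1) F = 0
  hsm : ∃ i, eval (e 1) (pderiv i F) ≠ 0
  hndvd : ¬ fh ∣ restr e F

namespace Dat
variable {n d : ℕ} {F : MvPolynomial (Fin 4) ℂ} {e : Fin 3 → Fin 4 → ℂ}
    {fh : MvPolynomial (Fin 3) ℂ} {u v : PowerSeries ℂ}

theorem fs_monic (D : Dat n d F e fh u v) :
    (finSuccEquiv ℂ 2 fh).Monic ∧ (finSuccEquiv ℂ 2 fh).natDegree = d := by
  obtain ⟨h1, h2⟩ := fs_lead fh d D.hfh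
  have h3 : (Fin.cons 1 0 : Fin 3 → ℂ) = ![1, 0, 0] := by
    ext i; fin_cases i <;> rfl
  rw [h3, D.hlead, C_1] at h2
  have h4 : (finSuccEquiv ℂ 2 fh).natDegree = d :=
    le_antisymm h1 (Polynomial.le_natDegree_of_ne_zero (by rw [h2]; exact one_ne_zero))
  refine ⟨?_, h4⟩
  rw [Polynomial.Monic, Polynomial.leadingCoeff, h4, h2]

theorem fs_irr (D : Dat n d F e fh u v) : Irreducible (finSuccEquiv ℂ 2 fh) :=
  (MulEquiv.irreducible_iff (finSuccEquiv ℂ 2)).2 D.hirr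

theorem elim (D : Dat n d F e fh u v) (g : Polynomial (MvPolynomial (Fin 2) ℂ))
    (hg : ¬ finSuccEquiv ℂ 2 fh ∣ g) :
    ∃ (a b : Polynomial (MvPolynomial (Fin 2) ℂ)) (E : MvPolynomial (Fin 2) ℂ), E ≠ 0 ∧
      a * finSuccEquiv ℂ 2 fh + b * g = Polynomial.C E :=
  bez_elim _ _ D.fs_monic.1 D.fs_irr hg

/-- formal point -/
noncomputable def fpt (u v : PowerSeries ℂ) : Fin 3 → Polynomial (PowerSeries ℂ) :=
  fun j => Polynomial.X * Polynomial.C ((![v, 1, u] : Fin 3 → PowerSeries ℂ) j)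

theorem fpt_eq (u v : PowerSeries ℂ) : fpt u v = Fin.cons (Polynomial.X * Polynomial.C v)
    (fun i => Polynomial.X * Polynomial.C ((![1, u] : Fin 2 → PowerSeries ℂ) i)) := by
  ext1 i
  fin_cases i <;> rfl

theorem fpt_fh (D : Dat n d F e fh u v) : aeval (fpt u v) fh = 0 := by
  ext1 m
  unfold fpt
  rw [coeff_aeval_lam, Polynomial.coeff_zero]
  by_cases hm : m = d
  · rw [hm, homogeneousComponent_of_mem D.hfh, if_pos rfl, D.harc]
  · rw [homogeneousComponent_of_mem D.hfh, if_neg hm, map_zero]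

theorem dvd_of_fpt (D : Dat n d F e fh u v) (g : MvPolynomial (Fin 3) ℂ)
    (hg : aeval (fpt u v) g = 0) : fh ∣ g := by
  by_contra hnd
  obtain ⟨a, b, E, hE, h⟩ := D.elim (finSuccEquiv ℂ 2 g)
    (fun h => hnd ((map_dvd_iff (finSuccEquiv ℂ 2)).1 h))
  apply hE
  have h1 := D.fpt_fh
  rw [fpt_eq, aeval_fs] at h1 hg
  have h2 := congrArg (Polynomial.eval₂ (aeval (fun i => Polynomial.X * Polynomial.C ((![1, u] : Fin 2 → PowerSeries ℂ) i)) : MvPolynomial (Fin 2) ℂ →ₐ[ℂ] _).toRingHom (Polynomial.X * Polynomial.C v)) h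
  rw [Polynomial.eval₂_add, Polynomial.eval₂_mul, Polynomial.eval₂_mul, h1, hg, mul_zero, mul_zero,
    add_zero, Polynomial.eval₂_C] at h2
  exact form2_inj u D.hu D.hu0 E h2.symm
end Dat
end
end

section
section
open MvPolynomial

theorem lin_prod {Q : Type*} [CommRing Q] {σ : Type*} (s : Finset σ) (m : σ → ℕ) (a b : σ → Q) :
    (∏ i ∈ s, (Polynomial.C (a i) + Polynomial.X * Polynomial.C (b i)) ^ m i).natDegree
      ≤ ∑ i ∈ s, m i ∧
    (∏ i ∈ s, (Polynomial.C (a i) + Polynomial.X * Polynomial.C (b i)) ^ m i).coeff (∑ i ∈ s, m i)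
      = ∏ i ∈ s, b i ^ m i := by
  classical
  have hl : ∀ i, (Polynomial.C (a i) + Polynomial.X * Polynomial.C (b i)).natDegree ≤ 1 := by
    intro i
    rw [add_comm, Polynomial.X_mul_C]
    exact Polynomial.natDegree_linear_le
  induction s using Finset.induction_on with
  | empty => simp
  | insert i s hi ih =>
    rw [Finset.prod_insert hi, Finset.sum_insert hi, Finset.prod_insert hi]
    have h1 : ((Polynomial.C (a i) + Polynomial.X * Polynomial.C (b i)) ^ m i).natDegree ≤ m i := by
      have := Polynomial.natDegree_pow_le_of_le (m i) (hl i)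
      simpa using this
    refine ⟨Polynomial.natDegree_mul_le_of_le h1 ih.1, ?_⟩
    rw [Polynomial.coeff_mul_add_eq_of_natDegree_le h1 ih.1, ih.2]
    congr 1
    have := Polynomial.coeff_pow_of_natDegree_le (m := m i) (hl i)
    rw [mul_one] at this
    rw [this]
    simp

theorem lead_lin {Q : Type*} [CommRing Q] [Algebra ℂ Q] {σ : Type*} (F : MvPolynomial σ ℂ) (n : ℕ)
    (hF : F.IsHomogeneous n) (a b : σ → Q) :
    (aeval (fun i => Polynomial.C (a i) + Polynomial.X * Polynomial.C (b i)) F).natDegree ≤ n ∧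
    (aeval (fun i => Polynomial.C (a i) + Polynomial.X * Polynomial.C (b i)) F).coeff n =
      aeval b F := by
  rw [aeval_def, aeval_def, eval₂_eq, eval₂_eq]
  have hw : ∀ m ∈ F.support, ∑ i ∈ m.support, m i = n := by
    intro m hm
    have := hF (mem_support_iff.1 hm)
    rw [← this, Finsupp.weight_apply, Finsupp.sum]
    simp
  constructor
  · refine Polynomial.natDegree_sum_le_of_forall_le _ _ fun m hm => ?_
    rw [IsScalarTower.algebraMap_apply ℂ Q (Polynomial Q)]
    refine (Polynomial.natDegree_C_mul_le _ _).trans ?_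
    rw [← hw m hm]
    exact (lin_prod m.support m a b).1
  · rw [Polynomial.finsetSum_coeff]
    refine Finset.sum_congr rfl fun m hm => ?_
    rw [IsScalarTower.algebraMap_apply ℂ Q (Polynomial Q)]
    change (Polynomial.C _ * _).coeff n = _
    rw [Polynomial.coeff_C_mul, ← (lin_prod m.support m a b).2, hw m hm]

theorem chain_rule {Q : Type*} [CommRing Q] [Algebra ℂ Q] (F : MvPolynomial (Fin 4) ℂ)
    (g : Fin 4 → Polynomial Q) :
    Polynomial.derivative (aeval g F) = ∑ i, aeval g (pderiv i F) * Polynomial.derivative (g i) := by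
  induction F using MvPolynomial.induction_on with
  | C a =>
    have : aeval g (C a) = Polynomial.C (algebraMap ℂ Q a) := by
      rw [← algebraMap_eq, AlgHom.commutes]; rfl
    rw [this]; simp
  | add p q hp hq =>
    simp only [map_add, hp, hq, add_mul, Finset.sum_add_distrib]
  | mul_X p j hp =>
    have key : ∀ i, aeval g (pderiv i (p * X j)) * Polynomial.derivative (g i) =
        (aeval g (pderiv i p) * Polynomial.derivative (g i)) * g j +
          (if i = j then aeval g p * Polynomial.derivative (g i) else 0) := by
      intro i
      rw [Derivation.leibniz, smul_eq_mul, smul_eq_mul, map_add, map_mul, map_mul, aeval_X]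
      split_ifs with hij
      · subst hij
        rw [pderiv_X_self, map_one]; ring
      · rw [pderiv_X_of_ne (fun h => hij h.symm), map_zero]; ring
    rw [Finset.sum_congr rfl fun i _ => key i, Finset.sum_add_distrib, ← Finset.sum_mul, ← hp,
      Finset.sum_ite_eq' Finset.univ j, if_pos (Finset.mem_univ j), map_mul, aeval_X,
      Polynomial.derivative_mul]

namespace Dat
variable {n d : ℕ} {F : MvPolynomial (Fin 4) ℂ} {e : Fin 3 → Fin 4 → ℂ}
    {fh : MvPolynomial (Fin 3) ℂ} {u v : PowerSeries ℂ}

theorem cc_map {R R' : Type*} [CommRing R] [CommRing R'] (φ : R →+* R') (a : PowerSeries R) :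
    PowerSeries.constantCoeff (PowerSeries.map φ a) = φ (PowerSeries.constantCoeff a) := by
  rw [← PowerSeries.coeff_zero_eq_constantCoeff_apply, PowerSeries.coeff_map,
    PowerSeries.coeff_zero_eq_constantCoeff_apply]

/-- formal point on the curve -/
noncomputable def qR (R : Type*) [CommRing R] [Algebra ℂ R] (e : Fin 3 → Fin 4 → ℂ)
    (u v : PowerSeries ℂ) : Fin 4 → PowerSeries R :=
  fun i => ∑ j, PowerSeries.C (algebraMap ℂ R (e j i)) *
    PowerSeries.map (algebraMap ℂ R) ((![v, 1, u] : Fin 3 → PowerSeries ℂ) j)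

theorem qR_const (D : Dat n d F e fh u v) (R : Type*) [CommRing R] [Algebra ℂ R] (i : Fin 4) :
    PowerSeries.constantCoeff (qR R e u v i) = algebraMap ℂ R (e 1 i) := by
  simp [qR, Fin.sum_univ_three, cc_map, D.hu, D.hv]

theorem aeval_const {R : Type*} [CommRing R] [Algebra ℂ R] (g : MvPolynomial (Fin 4) ℂ)
    (a : Fin 4 → PowerSeries R) (c : Fin 4 → ℂ)
    (h : ∀ i, PowerSeries.constantCoeff (a i) = algebraMap ℂ R (c i)) :
    PowerSeries.constantCoeff (aeval a g) = algebraMap ℂ R (eval c g) := by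
  rw [aeval_def, ← MvPolynomial.coe_eval₂Hom, ← RingHom.comp_apply, ← RingHom.comp_apply]
  congr 1
  apply MvPolynomial.ringHom_ext
  · intro r
    simp [PowerSeries.algebraMap_apply]
  · intro i
    simp [h]

theorem hens_gen (D : Dat n d F e fh u v) {R : Type*} [CommRing R] [Algebra ℂ R] (p : Fin 4 → R)
    (h1 : IsUnit (aeval p F))
    (h2 : IsUnit (∑ i, algebraMap ℂ R (eval (e 1) (pderiv i F)) * p i)) :
    ∃ t : PowerSeries R, PowerSeries.constantCoeff t = 0 ∧
      aeval (fun i => qR R e u v i + t * PowerSeries.C (p i)) F = 0 := by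
  nontriviality R
  set G := aeval (fun i => Polynomial.C (qR R e u v i) +
    Polynomial.X * Polynomial.C (PowerSeries.C (p i))) F with hG
  obtain ⟨hdeg, hco⟩ := lead_lin F n D.hF (qR R e u v) (fun i => PowerSeries.C (p i))
  have hco' : G.coeff n = PowerSeries.C (aeval p F) := by
    rw [hG, hco, aeval_def, aeval_def, MvPolynomial.hom_eval₂]
    congr 1
    ext r : 1
    rw [PowerSeries.algebraMap_apply]; rfl
  have hev : ∀ (x : PowerSeries R) (g : MvPolynomial (Fin 4) ℂ), Polynomial.eval x (aeval (fun i => Polynomial.C (qR R e u v i) +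
    Polynomial.X * Polynomial.C (PowerSeries.C (p i))) g) = aeval (fun i => qR R e u v i + x * PowerSeries.C (p i)) g := by
    intro x g
    rw [aeval_def, aeval_def, ← Polynomial.coe_evalRingHom, MvPolynomial.hom_eval₂]
    congr 1
    · ext r
      simp [Polynomial.algebraMap_apply]
    · ext1 i
      change Polynomial.eval x _ = _
      rw [Polynomial.eval_add, Polynomial.eval_mul, Polynomial.eval_X, Polynomial.eval_C,
        Polynomial.eval_C]
  have hu1 : IsUnit (G.coeff n) := by rw [hco']; exact h1.map _
  have hnd : G.natDegree = n := le_antisymm hdeg (Polynomial.le_natDegree_of_ne_zero hu1.ne_zero)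
  obtain ⟨t, ht, ht'⟩ := hensel_root G (by rw [Polynomial.leadingCoeff, hnd]; exact hu1)
    (by
      rw [hG, hev, aeval_const F _ (e 1) (by intro i; simp [D.qR_const]), D.hq0, map_zero])
    (by
      rw [hG, chain_rule, Polynomial.eval_finsetSum, map_sum]
      convert h2 using 1
      refine Finset.sum_congr rfl fun i _ => ?_
      rw [Polynomial.eval_mul, hev, map_mul, aeval_const _ _ (e 1) (by intro i; simp [D.qR_const])]
      simp)
  exact ⟨t, ht, by rw [← hev]; exact ht'⟩
end Dat
end
end

section
section
open MvPolynomial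

theorem hom_aeval {σ : Type*} {A B : Type*} [CommRing A] [CommRing B] [Algebra ℂ A] [Algebra ℂ B]
    (φ : A →+* B) (hφ : ∀ c, φ (algebraMap ℂ A c) = algebraMap ℂ B c) (g : σ → A)
    (F : MvPolynomial σ ℂ) : φ (aeval g F) = aeval (fun i => φ (g i)) F := by
  rw [aeval_def, aeval_def, MvPolynomial.hom_eval₂]
  congr 1
  ext c : 1
  exact hφ c

namespace Dat
variable {n d : ℕ} {F : MvPolynomial (Fin 4) ℂ} {e : Fin 3 → Fin 4 → ℂ}
    {fh : MvPolynomial (Fin 3) ℂ} {u v : PowerSeries ℂ}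

/-- formal point over R -/
noncomputable def fptR (R : Type*) [CommRing R] [Algebra ℂ R] (u v : PowerSeries ℂ) :
    Fin 3 → Polynomial (PowerSeries R) :=
  fun j => Polynomial.X * Polynomial.C (PowerSeries.map (algebraMap ℂ R)
    ((![v, 1, u] : Fin 3 → PowerSeries ℂ) j))

theorem kerS (D : Dat n d F e fh u v) (H0 : MvPolynomial (Fin 4) ℂ) (hH0 : H0 ≠ 0)
    {R : Type*} [CommRing R] [Algebra ℂ R] [Algebra (MvPolynomial (Fin 4) ℂ) R]
    [IsScalarTower ℂ (MvPolynomial (Fin 4) ℂ) R] [IsLocalization.Away H0 R]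
    (g : MvPolynomial (Fin 3) (MvPolynomial (Fin 4) ℂ))
    (hg : eval₂ (Polynomial.C.comp (PowerSeries.C.comp (algebraMap (MvPolynomial (Fin 4) ℂ) R)))
      (fptR R u v) g = 0) (y : Fin 3 → ℂ) (hy : eval y fh = 0) :
    eval (fun j => C (y j)) g = 0 := by
  have key : eval (fun j => C (y j)) g * H0 = 0 := by
    apply MvPolynomial.funext
    intro p0
    rw [map_mul, map_zero]
    by_cases hp : eval p0 H0 = 0
    · rw [hp, mul_zero]
    let φ : R →+* ℂ := IsLocalization.Away.lift (S := R) H0 (g := eval p0) (isUnit_iff_ne_zero.2 hp)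
    have hφ : φ.comp (algebraMap (MvPolynomial (Fin 4) ℂ) R) = eval p0 :=
      IsLocalization.Away.lift_comp H0 _
    have hφ' : φ.comp (algebraMap ℂ R) = RingHom.id ℂ := by
      rw [IsScalarTower.algebraMap_eq ℂ (MvPolynomial (Fin 4) ℂ) R, ← RingHom.comp_assoc, hφ]
      ext c <;> simp
    have h1 := congrArg (Polynomial.mapRingHom (PowerSeries.map φ)) hg
    rw [MvPolynomial.hom_eval₂, map_zero] at h1
    have h2 : aeval (fpt u v) (MvPolynomial.map (eval p0) g) = 0 := by
      rw [← h1, aeval_def, eval₂_map]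
      congr 1
      · rw [← hφ]
        refine RingHom.ext fun x => ?_
        simp only [RingHom.comp_apply, Polynomial.coe_mapRingHom, Polynomial.map_C, PowerSeries.map_C]
        rw [Polynomial.algebraMap_apply, PowerSeries.algebraMap_apply]
        rfl
      · ext1 j
        simp only [fpt, fptR, Function.comp_apply, Polynomial.coe_mapRingHom, Polynomial.map_mul,
          Polynomial.map_X, Polynomial.map_C]
        rw [← RingHom.comp_apply (PowerSeries.map φ), ← PowerSeries.map_comp, hφ']
        simp
    obtain ⟨k, hk⟩ := D.dvd_of_fpt _ h2
    have h3 : eval y (MvPolynomial.map (eval p0) g) = 0 := by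
      rw [hk, map_mul, hy, zero_mul]
    have h4 : eval p0 (eval (fun j => C (y j)) g) = eval y (MvPolynomial.map (eval p0) g) := by
      rw [eval_map]
      change eval p0 (eval₂ (RingHom.id _) _ g) = _
      rw [MvPolynomial.hom_eval₂, RingHom.comp_id]
      congr 1
      ext1 j
      simp
    rw [h4, h3, zero_mul]
  exact (mul_eq_zero.1 key).resolve_right hH0

/-- index set -/
def JJ (N : ℕ) : Finset (ℕ × ℕ) :=
  (Finset.range (N+1) ×ˢ Finset.range (N+1)).filter (fun a => a.1 + a.2 ≤ N)

theorem mem_JJ {N : ℕ} {a : ℕ × ℕ} : a ∈ JJ N ↔ a.1 + a.2 ≤ N := by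
  simp only [JJ, Finset.mem_filter, Finset.mem_product, Finset.mem_range]
  omega

noncomputable def cc (e : Fin 3 → Fin 4 → ℂ) (y : Fin 3 → ℂ) : Fin 4 → ℂ := ∑ j, y j • e j

noncomputable def Gt (F : MvPolynomial (Fin 4) ℂ) (c : Fin 4 → ℂ) :
    Polynomial (MvPolynomial (Fin 4) ℂ) :=
  aeval (fun i => Polynomial.C (X i) + Polynomial.X * Polynomial.C (C (c i))) F

noncomputable def Pt (N : ℕ) (r : ℕ × ℕ → MvPolynomial (Fin 4) ℂ) (y1 y2 : ℂ) :
    Polynomial (MvPolynomial (Fin 4) ℂ) :=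
  ∑ a ∈ JJ N, Polynomial.C (r a * C (y1 ^ (N - a.1 - a.2) * y2 ^ a.1)) * Polynomial.X ^ (N - a.2)

section gen
variable {A B : Type*} [CommRing A] [CommRing B] [Algebra ℂ A] [Algebra ℂ B]

/-- generic versions -/
noncomputable def LL (F : MvPolynomial (Fin 4) ℂ) (e : Fin 3 → Fin 4 → ℂ) (Y : Fin 3 → A)
    (p : Fin 4 → A) : Polynomial A :=
  aeval (fun i => Polynomial.C (∑ j, algebraMap ℂ A (e j i) * Y j) +
    Polynomial.X * Polynomial.C (p i)) F

theorem LL_eval₂ (φ : A →+* B) (hφ : ∀ c, φ (algebraMap ℂ A c) = algebraMap ℂ B c)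
    (Y : Fin 3 → A) (p : Fin 4 → A) (T : B) :
    (LL F e Y p).eval₂ φ T =
      aeval (fun i => (∑ j, algebraMap ℂ B (e j i) * φ (Y j)) + T * φ (p i)) F := by
  rw [LL, ← Polynomial.coe_eval₂RingHom, hom_aeval]
  · congr 2
    ext1 i
    rw [map_add, map_mul, Polynomial.coe_eval₂RingHom, Polynomial.eval₂_C, Polynomial.eval₂_C,
      Polynomial.eval₂_X, map_sum]
    simp only [map_mul, hφ]
  · intro c
    rw [Polynomial.algebraMap_apply, Polynomial.coe_eval₂RingHom, Polynomial.eval₂_C, hφ]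

theorem LL_map (φ : A →+* B) (hφ : ∀ c, φ (algebraMap ℂ A c) = algebraMap ℂ B c)
    (Y : Fin 3 → A) (p : Fin 4 → A) :
    (LL F e Y p).map φ = LL F e (fun j => φ (Y j)) (fun j => φ (p j)) := by
  rw [LL, ← Polynomial.coe_mapRingHom, hom_aeval]
  · rw [LL]
    congr 2
    ext1 i
    rw [Polynomial.coe_mapRingHom, Polynomial.map_add, Polynomial.map_mul, Polynomial.map_C,
      Polynomial.map_C, Polynomial.map_X, map_sum]
    simp only [map_mul, hφ]
  · intro c
    rw [Polynomial.algebraMap_apply, Polynomial.coe_mapRingHom, Polynomial.map_C, hφ]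
    rfl

noncomputable def PT (N : ℕ) (r : ℕ × ℕ → A) (Y1 Y2 : A) : Polynomial A :=
  ∑ a ∈ JJ N, Polynomial.C (r a * (Y1 ^ (N - a.1 - a.2) * Y2 ^ a.1)) * Polynomial.X ^ a.2

theorem PT_eval₂ (φ : A →+* B) (N : ℕ) (r : ℕ × ℕ → A) (Y1 Y2 : A) (T : B) :
    (PT N r Y1 Y2).eval₂ φ T = ∑ a ∈ JJ N, φ (r a) *
      (φ Y1 ^ (N - a.1 - a.2) * φ Y2 ^ a.1) * T ^ a.2 := by
  rw [PT, Polynomial.eval₂_finsetSum]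
  refine Finset.sum_congr rfl fun a _ => ?_
  rw [Polynomial.eval₂_mul, Polynomial.eval₂_C, Polynomial.eval₂_pow, Polynomial.eval₂_X,
    map_mul, map_mul, map_pow, map_pow]

theorem PT_map (φ : A →+* B) (N : ℕ) (r : ℕ × ℕ → A) (Y1 Y2 : A) :
    (PT N r Y1 Y2).map φ = PT N (fun a => φ (r a)) (φ Y1) (φ Y2) := by
  rw [PT, PT, Polynomial.map_sum]
  refine Finset.sum_congr rfl fun a _ => ?_
  rw [Polynomial.map_mul, Polynomial.map_C, Polynomial.map_pow, Polynomial.map_X,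
    map_mul φ, map_mul φ, map_pow φ, map_pow φ]

theorem PT_deg (N : ℕ) (r : ℕ × ℕ → A) (Y1 Y2 : A) :
    (PT N r Y1 Y2).natDegree ≤ N := by
  refine Polynomial.natDegree_sum_le_of_forall_le _ _ fun a ha => ?_
  have := mem_JJ.1 ha
  exact (Polynomial.natDegree_C_mul_X_pow_le _ _).trans (by omega)

theorem formal_zero {R : Type*} [CommRing R] [Algebra ℂ R] (hF : F.IsHomogeneous n)
    (t0 : PowerSeries R) (p : Fin 4 → R)
    (ht : aeval (fun i => qR R e u v i + t0 * PowerSeries.C (p i)) F = 0) :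
    aeval (fun i => (∑ j, algebraMap ℂ (Polynomial (PowerSeries R)) (e j i) * fptR R u v j) +
      (Polynomial.X * Polynomial.C t0) * Polynomial.C (PowerSeries.C (p i))) F = 0 := by
  have h1 : (fun i => (∑ j, algebraMap ℂ (Polynomial (PowerSeries R)) (e j i) * fptR R u v j) +
      (Polynomial.X * Polynomial.C t0) * Polynomial.C (PowerSeries.C (p i))) =
      fun i => Polynomial.X * Polynomial.C (qR R e u v i + t0 * PowerSeries.C (p i)) := by
    funext i
    have ha : ∀ c : ℂ, algebraMap ℂ (Polynomial (PowerSeries R)) c =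
        Polynomial.C (PowerSeries.C (algebraMap ℂ R c)) := fun c => by
      rw [Polynomial.algebraMap_apply, PowerSeries.algebraMap_apply]
    have hb : Polynomial.C (qR R e u v i) = ∑ j, Polynomial.C (PowerSeries.C (algebraMap ℂ R (e j i))) *
        Polynomial.C (PowerSeries.map (algebraMap ℂ R) ((![v, 1, u] : Fin 3 → PowerSeries ℂ) j)) := by
      unfold qR
      rw [map_sum]
      exact Finset.sum_congr rfl fun j _ => Polynomial.C_mul
    rw [Polynomial.C_add, Polynomial.C_mul, mul_add, hb, Finset.mul_sum, mul_assoc]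
    refine congrArg (· + _) (Finset.sum_congr rfl fun j _ => ?_)
    rw [ha]
    exact mul_left_comm _ _ _
  have h2 := hom_aeval (Polynomial.C : PowerSeries R →+* _) (fun c => rfl)
    (fun i => qR R e u v i + t0 * PowerSeries.C (p i)) F
  rw [h1, homog_scale F n hF, ← h2, ht, map_zero, mul_zero]

theorem formal_P {R : Type*} [CommRing R] [Algebra ℂ R]
    (t0 : PowerSeries R) (N : ℕ) (r : ℕ × ℕ → R)
    (hr : ∑ a ∈ JJ N, PowerSeries.C (r a) *
      (PowerSeries.map (algebraMap ℂ R) u ^ a.1 * t0 ^ a.2) = 0) :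
    ∑ a ∈ JJ N, Polynomial.C (PowerSeries.C (r a)) * (fptR R u v 1 ^ (N - a.1 - a.2) *
      fptR R u v 2 ^ a.1) * (Polynomial.X * Polynomial.C t0) ^ a.2 = 0 := by
  have h := congrArg (fun z => Polynomial.X ^ N * Polynomial.C z) hr
  simp only [map_zero, mul_zero] at h
  rw [← h, map_sum, Finset.mul_sum]
  refine Finset.sum_congr rfl fun a ha => ?_
  have h3 := mem_JJ.1 ha
  have h4 : (Polynomial.X : Polynomial (PowerSeries R)) ^ N =
    Polynomial.X ^ (N - a.1 - a.2) * Polynomial.X ^ a.1 * Polynomial.X ^ a.2 := by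
    rw [← pow_add, ← pow_add]; congr 1; omega
  have h5 : fptR R u v 1 = Polynomial.X := by simp [fptR]
  have h6 : fptR R u v 2 = Polynomial.X * Polynomial.C (PowerSeries.map (algebraMap ℂ R) u) := rfl
  rw [h4, h5, h6, map_mul, map_mul, map_pow, map_pow, mul_pow, mul_pow]
  ring
end gen

theorem Pt_deg (N : ℕ) (r : ℕ × ℕ → MvPolynomial (Fin 4) ℂ) (y1 y2 : ℂ) :
    (Pt N r y1 y2).natDegree ≤ N := by
  refine Polynomial.natDegree_sum_le_of_forall_le _ _ fun a ha => ?_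
  exact (Polynomial.natDegree_C_mul_X_pow_le _ _).trans (by omega)

theorem res_zero (D : Dat n d F e fh u v) (H0 : MvPolynomial (Fin 4) ℂ) (hH0 : H0 ≠ 0)
    {R : Type*} [CommRing R] [Algebra ℂ R] [Algebra (MvPolynomial (Fin 4) ℂ) R]
    [IsScalarTower ℂ (MvPolynomial (Fin 4) ℂ) R] [IsLocalization.Away H0 R]
    (t0 : PowerSeries R)
    (ht : aeval (fun i => qR R e u v i + t0 * PowerSeries.C (algebraMap (MvPolynomial (Fin 4) ℂ) R (X i))) F = 0)
    (N : ℕ) (r : ℕ × ℕ → MvPolynomial (Fin 4) ℂ)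
    (hr : ∑ a ∈ JJ N, PowerSeries.C (algebraMap (MvPolynomial (Fin 4) ℂ) R (r a)) *
      (PowerSeries.map (algebraMap ℂ R) u ^ a.1 * t0 ^ a.2) = 0)
    (y : Fin 3 → ℂ) (hy : eval y fh = 0) :
    Polynomial.resultant (LL F e (fun j => (C (y j) : MvPolynomial (Fin 4) ℂ)) X)
      (PT N r (C (y 1)) (C (y 2))) n N = 0 := by
  set G := LL F e (fun j => (X j : MvPolynomial (Fin 3) (MvPolynomial (Fin 4) ℂ)))
    (fun i => C (X i)) with hG
  set P := PT N (fun a => (C (r a) : MvPolynomial (Fin 3) (MvPolynomial (Fin 4) ℂ))) (X 1) (X 2)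
    with hP
  have hGGdeg : G.natDegree ≤ n := (lead_lin F n D.hF _ _).1
  obtain ⟨a, b, -, -, hab⟩ := Polynomial.exists_mul_add_mul_eq_C_resultant G P
    hGGdeg (PT_deg N _ _ _) (Or.inl D.hn.ne')
  have e1 : G.map (eval (fun j => C (y j))) = LL F e (fun j => (C (y j) : MvPolynomial (Fin 4) ℂ)) X := by
    rw [hG, LL_map]
    · simp only [eval_X, eval_C]
    · intro c
      rw [MvPolynomial.algebraMap_apply, eval_C]
  have e2 : P.map (eval (fun j => C (y j))) = PT N r (C (y 1)) (C (y 2)) := by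
    rw [hP, PT_map]
    simp only [eval_X, eval_C]
  rw [← e1, ← e2, Polynomial.resultant_map_map]
  refine D.kerS H0 hH0 (R := R) _ ?_ y hy
  set θ := eval₂Hom (Polynomial.C.comp (PowerSeries.C.comp (algebraMap (MvPolynomial (Fin 4) ℂ) R)))
      (fptR R u v) with hθ
  have hθX : ∀ j, θ (X j) = fptR R u v j := fun j => by rw [hθ, eval₂Hom_X']
  have hθC : ∀ s, θ (C s) = Polynomial.C (PowerSeries.C (algebraMap (MvPolynomial (Fin 4) ℂ) R s)) := fun s => by
    rw [hθ, eval₂Hom_C]; rfl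
  have h1 := congrArg (Polynomial.eval₂ θ (Polynomial.X * Polynomial.C t0)) hab
  rw [Polynomial.eval₂_C, Polynomial.eval₂_add, Polynomial.eval₂_mul, Polynomial.eval₂_mul] at h1
  have hG0 : Polynomial.eval₂ θ (Polynomial.X * Polynomial.C t0) G = 0 := by
    rw [hG, LL_eval₂]
    · simp only [hθX, hθC]
      exact formal_zero D.hF t0 _ ht
    · intro c
      rw [MvPolynomial.algebraMap_apply, hθC, ← IsScalarTower.algebraMap_apply,
        Polynomial.algebraMap_apply, PowerSeries.algebraMap_apply]
  have hP0 : Polynomial.eval₂ θ (Polynomial.X * Polynomial.C t0) P = 0 := by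
    rw [hP, PT_eval₂]
    simp only [hθX, hθC]
    exact formal_P t0 N _ hr
  rw [hG0, hP0, zero_mul, zero_mul, add_zero] at h1
  exact h1.symm
end Dat
end
end

section
section
open MvPolynomial
namespace Dat
variable {n d : ℕ} {F : MvPolynomial (Fin 4) ℂ} {e : Fin 3 → Fin 4 → ℂ}
    {fh : MvPolynomial (Fin 3) ℂ} {u v : PowerSeries ℂ}

noncomputable def shiftHom (c : Fin 4 → ℂ) :
    Polynomial (MvPolynomial (Fin 4) ℂ) →+* Polynomial (MvPolynomial (Fin 4) ℂ) :=
  Polynomial.eval₂RingHom (aeval (fun i => Polynomial.C (X i) + Polynomial.X * Polynomial.C (C (c i))) :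
    MvPolynomial (Fin 4) ℂ →ₐ[ℂ] Polynomial (MvPolynomial (Fin 4) ℂ)).toRingHom Polynomial.X

theorem shiftHom_C (c : Fin 4 → ℂ) (g : MvPolynomial (Fin 4) ℂ) :
    shiftHom c (Polynomial.C g) = Gt g c := by
  rw [shiftHom, Polynomial.coe_eval₂RingHom, Polynomial.eval₂_C]
  rfl

theorem shiftHom_X (c : Fin 4 → ℂ) : shiftHom c Polynomial.X = Polynomial.X := by
  rw [shiftHom, Polynomial.coe_eval₂RingHom, Polynomial.eval₂_X]

theorem Gt_C (c : Fin 4 → ℂ) (z : ℂ) : Gt (C z) c = Polynomial.C (C z) := by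
  rw [Gt, aeval_C]; rfl

theorem Gt_X (c : Fin 4 → ℂ) (i : Fin 4) : Gt (X i) c =
    Polynomial.C (X i) + Polynomial.X * Polynomial.C (C (c i)) := by
  rw [Gt, aeval_X]

theorem shiftHom_comp (c c' : Fin 4 → ℂ) (h : ∀ i, c i + c' i = 0) :
    (shiftHom c).comp (shiftHom c') = RingHom.id _ := by
  apply Polynomial.ringHom_ext'
  · apply MvPolynomial.ringHom_ext
    · intro z
      simp only [RingHom.comp_apply, shiftHom_C, Gt_C, RingHom.id_apply]
    · intro i
      simp only [RingHom.comp_apply, shiftHom_C, Gt_X, RingHom.id_apply, map_add, map_mul, Gt_C,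
        shiftHom_X]
      rw [add_assoc, ← mul_add, ← Polynomial.C_add, ← C_add, h]
      simp
  · simp only [RingHom.comp_apply, shiftHom_X, RingHom.id_apply]

theorem Gt_prime (hF : Irreducible F) (c : Fin 4 → ℂ) : Prime (Gt F c) := by
  rw [← shiftHom_C]
  let E := RingEquiv.ofRingHom (shiftHom c) (shiftHom (-c)) (shiftHom_comp _ _ (fun i => by simp))
    (shiftHom_comp _ _ (fun i => by simp))
  have h : Prime (E (Polynomial.C F)) :=
    (MulEquiv.prime_iff E).2 (Polynomial.prime_C_iff.2 hF.prime)
  exact h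

theorem Gt_lead (hF : F.IsHomogeneous n) (c : Fin 4 → ℂ) :
    (Gt F c).natDegree ≤ n ∧ (Gt F c).coeff n = C (eval c F) := by
  obtain ⟨h1, h2⟩ := lead_lin F n hF (fun i => (X i : MvPolynomial (Fin 4) ℂ)) (fun i => C (c i))
  refine ⟨h1, h2.trans ?_⟩
  have := hom_aeval (C : ℂ →+* MvPolynomial (Fin 4) ℂ) (fun c => rfl) c F
  rw [← this, MvPolynomial.aeval_eq_eval]

theorem Gt_natDegree (hF : F.IsHomogeneous n) (c : Fin 4 → ℂ) (hc : eval c F ≠ 0) :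
    (Gt F c).natDegree = n :=
  le_antisymm (Gt_lead hF c).1 (Polynomial.le_natDegree_of_ne_zero
    (by rw [(Gt_lead hF c).2]; simpa using hc))

theorem Gt_dvd_Pt_aux (hF : F.IsHomogeneous n) (hFirr : Irreducible F) (N : ℕ)
    (r : ℕ × ℕ → MvPolynomial (Fin 4) ℂ) (y : Fin 3 → ℂ)
    {Ω : Type*} [Field Ω] [Algebra ℂ Ω] (φ : MvPolynomial (Fin 4) ℂ →+* Ω)
    (hφC : ∀ c, φ (algebraMap ℂ _ c) = algebraMap ℂ Ω c) (hφi : Function.Injective φ)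
    (t : Ω) (ht1 : Polynomial.eval₂ φ t (LL F e (fun j => (C (y j) : MvPolynomial (Fin 4) ℂ)) X) = 0)
    (ht2 : Polynomial.eval₂ φ t (PT N r (C (y 1)) (C (y 2))) = 0) (hc : eval (cc e y) F ≠ 0) :
    Gt F (cc e y) ∣ Pt N r (y 1) (y 2) := by
  rw [LL_eval₂ _ hφC] at ht1
  rw [PT_eval₂] at ht2
  have hcc : ∀ i, ∑ j, algebraMap ℂ Ω (e j i) * φ (C (y j)) = algebraMap ℂ Ω (cc e y i) := by
    intro i
    rw [cc, Finset.sum_apply, map_sum]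
    refine Finset.sum_congr rfl fun j _ => ?_
    rw [Pi.smul_apply, smul_eq_mul, map_mul, mul_comm]
    congr 1
    exact hφC _
  simp only [hcc] at ht1
  have ht : t ≠ 0 := by
    rintro rfl
    simp only [zero_mul, add_zero] at ht1
    rw [← hom_aeval (algebraMap ℂ Ω) (fun _ => rfl), MvPolynomial.aeval_eq_eval,
      map_eq_zero] at ht1
    exact hc ht1
  have h1 : Polynomial.eval₂ φ t⁻¹ (Gt F (cc e y)) = 0 := by
    rw [Gt, ← Polynomial.coe_eval₂RingHom, hom_aeval]
    · have : (fun i => Polynomial.eval₂RingHom φ t⁻¹ (Polynomial.C (X i) + Polynomial.X *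
          Polynomial.C (C (cc e y i)))) = fun i => t⁻¹ * (algebraMap ℂ Ω (cc e y i) + t * φ (X i)) := by
        funext i
        rw [Polynomial.coe_eval₂RingHom, Polynomial.eval₂_add, Polynomial.eval₂_mul,
          Polynomial.eval₂_C, Polynomial.eval₂_C, Polynomial.eval₂_X, mul_add, ← mul_assoc,
          inv_mul_cancel₀ ht, one_mul, add_comm]
        congr 2
        exact hφC _
      rw [this, homog_scale F n hF, ht1, mul_zero]
    · intro c
      rw [Polynomial.algebraMap_apply, Polynomial.coe_eval₂RingHom, Polynomial.eval₂_C, hφC]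
  have h2 : Polynomial.eval₂ φ t⁻¹ (Pt N r (y 1) (y 2)) = 0 := by
    rw [Pt, Polynomial.eval₂_finsetSum]
    have h := congrArg (t⁻¹ ^ N * ·) ht2
    simp only [mul_zero, Finset.mul_sum] at h
    rw [← h]
    refine Finset.sum_congr rfl fun a ha => ?_
    have h3 := mem_JJ.1 ha
    rw [Polynomial.eval₂_mul, Polynomial.eval₂_C, Polynomial.eval₂_pow, Polynomial.eval₂_X,
      map_mul φ, C_mul, map_mul φ, C_pow, C_pow, map_pow φ, map_pow φ]
    have h4 : t⁻¹ ^ N = t⁻¹ ^ (N - a.2) * t⁻¹ ^ a.2 := by rw [← pow_add]; congr 1; omega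
    have h5 : t⁻¹ ^ a.2 * t ^ a.2 = 1 := by rw [← mul_pow, inv_mul_cancel₀ ht, one_pow]
    rw [h4]
    linear_combination (-(φ (r a) * (φ (C (y 1)) ^ (N - a.1 - a.2) * φ (C (y 2)) ^ a.1)) * t⁻¹ ^ (N - a.2)) * h5
  by_contra hnd
  have hu : IsUnit (Polynomial.C (C (eval (cc e y) F)⁻¹) : Polynomial (MvPolynomial (Fin 4) ℂ)) := by
    rw [Polynomial.isUnit_C]
    exact (isUnit_iff_ne_zero.2 (inv_ne_zero hc)).map C
  have hass : Associated (Gt F (cc e y)) (Polynomial.C (C (eval (cc e y) F)⁻¹) * Gt F (cc e y)) :=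
    (associated_unit_mul_left _ _ hu).symm
  have hmon : (Polynomial.C (C (eval (cc e y) F)⁻¹) * Gt F (cc e y)).Monic := by
    apply Polynomial.monic_of_natDegree_le_of_coeff_eq_one n
    · exact (Polynomial.natDegree_C_mul_le _ _).trans (Gt_lead hF _).1
    · rw [Polynomial.coeff_C_mul, (Gt_lead hF _).2, ← C_mul, inv_mul_cancel₀ hc, C_1]
  obtain ⟨a, b, D, hD, h⟩ := bez_elim _ (Pt N r (y 1) (y 2)) hmon
    (hass.irreducible (Gt_prime hFirr _).irreducible) (fun h => hnd (hass.dvd.trans h))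
  apply hD
  have h3 := congrArg (Polynomial.eval₂ φ t⁻¹) h
  rw [Polynomial.eval₂_add, Polynomial.eval₂_mul, Polynomial.eval₂_mul, Polynomial.eval₂_mul, h1, h2,
    mul_zero, mul_zero, mul_zero, add_zero, Polynomial.eval₂_C] at h3
  exact hφi (by rw [← h3, map_zero])

theorem Gt_dvd_Pt (hF : F.IsHomogeneous n) (hFirr : Irreducible F) (N : ℕ)
    (r : ℕ × ℕ → MvPolynomial (Fin 4) ℂ) (y : Fin 3 → ℂ)
    (hres : Polynomial.resultant (LL F e (fun j => (C (y j) : MvPolynomial (Fin 4) ℂ)) X)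
      (PT N r (C (y 1)) (C (y 2))) n N = 0) (hc : eval (cc e y) F ≠ 0) :
    Gt F (cc e y) ∣ Pt N r (y 1) (y 2) := by
  have hl := lead_lin F n hF (fun i => ∑ j, algebraMap ℂ (MvPolynomial (Fin 4) ℂ) (e j i) * C (y j)) X
  rw [aeval_X_left_apply] at hl
  obtain ⟨t, ht1, ht2⟩ := res_common_root _ _ n N hl.1 (by rw [hl.2]; exact hFirr.ne_zero)
    (PT_deg N r (C (y 1)) (C (y 2))) hres
  refine Gt_dvd_Pt_aux hF hFirr N r y (algebraMap _ _) (fun c =>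
    (IsScalarTower.algebraMap_apply ℂ (MvPolynomial (Fin 4) ℂ) _ c).symm) ?_ t ht1 ht2 hc
  rw [IsScalarTower.algebraMap_eq _ (FractionRing (MvPolynomial (Fin 4) ℂ)) _]
  exact (algebraMap (FractionRing (MvPolynomial (Fin 4) ℂ)) _).injective.comp
    (IsFractionRing.injective _ _)
end Dat
end
end

section
section
open MvPolynomial
namespace Dat
variable {n d : ℕ} {F : MvPolynomial (Fin 4) ℂ} {e : Fin 3 → Fin 4 → ℂ}
    {fh : MvPolynomial (Fin 3) ℂ} {u v : PowerSeries ℂ}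

theorem Gt_eval (c b : Fin 4 → ℂ) :
    Polynomial.eval₂ (eval (-b)) 1 (Gt F c) = eval (c - b) F := by
  rw [Gt, ← Polynomial.coe_eval₂RingHom, hom_aeval]
  · rw [MvPolynomial.aeval_eq_eval]
    congr 2
    funext i
    rw [Polynomial.coe_eval₂RingHom, Polynomial.eval₂_add, Polynomial.eval₂_mul,
          Polynomial.eval₂_C, Polynomial.eval₂_C, Polynomial.eval₂_X]
    simp
    ring
  · intro c
    rw [Polynomial.algebraMap_apply, Polynomial.coe_eval₂RingHom, Polynomial.eval₂_C]
    simp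

theorem cc_sub (x x' : ℂ) (s : Fin 2 → ℂ) :
    cc e (Fin.cons x s) - cc e (Fin.cons x' s) = (x - x') • e 0 := by
  simp only [cc, Fin.sum_univ_three]
  funext i
  have h1 : ∀ z : ℂ, (Fin.cons z s : Fin 3 → ℂ) 1 = s 0 := fun z => rfl
  have h2 : ∀ z : ℂ, (Fin.cons z s : Fin 3 → ℂ) 2 = s 1 := fun z => rfl
  simp only [h1, h2, Fin.cons_zero, Pi.sub_apply, Pi.add_apply, Pi.smul_apply, smul_eq_mul]
  ring

theorem Gt_relprime (D : Dat n d F e fh u v) (s : Fin 2 → ℂ) (x x' : ℂ) (hx : x ≠ x') :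
    IsRelPrime (Gt F (cc e (Fin.cons x s))) (Gt F (cc e (Fin.cons x' s))) := by
  rw [(Gt_prime D.hFirr _).irreducible.isRelPrime_iff_not_dvd]
  rintro ⟨k, hk⟩
  have h := congrArg (Polynomial.eval₂ (eval (-(cc e (Fin.cons x s)))) 1) hk
  rw [Polynomial.eval₂_mul, Gt_eval, Gt_eval, sub_self, cc_sub, homog_scale_eval F n D.hF] at h
  have h0 : eval (0 : Fin 4 → ℂ) F = 0 := by
    have := homog_scale_eval F n D.hF 0 0
    rw [zero_smul, zero_pow D.hn.ne', zero_mul] at this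
    exact this
  rw [h0, zero_mul] at h
  exact mul_ne_zero (pow_ne_zero _ (sub_ne_zero.2 hx.symm)) D.hFe h

theorem good_open (D : Dat n d F e fh u v) : ∃ M : MvPolynomial (Fin 2) ℂ, M ≠ 0 ∧
    ∀ s, eval s M ≠ 0 → ∃ A : Finset ℂ, A.card = d ∧ ∀ x ∈ A, eval (Fin.cons x s) fh = 0 ∧
      eval (cc e (Fin.cons x s)) F ≠ 0 := by
  obtain ⟨hm, hdeg⟩ := D.fs_monic
  have h1 : ¬ finSuccEquiv ℂ 2 fh ∣ Polynomial.derivative (finSuccEquiv ℂ 2 fh) := by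
    apply Polynomial.Monic.not_dvd_of_natDegree_lt hm
    · intro h
      have := Polynomial.derivative_eq_zero.1 h
      rw [hdeg] at this
      exact D.hd.ne' this
    · exact Polynomial.natDegree_derivative_lt (by rw [hdeg]; exact D.hd.ne')
  have h2 : ¬ finSuccEquiv ℂ 2 fh ∣ finSuccEquiv ℂ 2 (restr e F) :=
    fun h => D.hndvd ((map_dvd_iff (finSuccEquiv ℂ 2)).1 h)
  obtain ⟨a, b, E, hE, h3⟩ := D.elim _ h1
  obtain ⟨a', b', E', hE', h4⟩ := D.elim _ h2
  refine ⟨E * E', mul_ne_zero hE hE', fun s hs => ?_⟩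
  rw [map_mul] at hs
  set q := (finSuccEquiv ℂ 2 fh).map (eval s) with hq
  have hqm : q.Monic := hm.map _
  have hqd : q.natDegree = d := by rw [hq, hm.natDegree_map, hdeg]
  have hsep : q.Separable := by
    have h5 := congrArg (Polynomial.map (eval s)) h3
    rw [Polynomial.map_add, Polynomial.map_mul, Polynomial.map_mul, Polynomial.map_C,
      ← Polynomial.derivative_map, ← hq] at h5
    refine ⟨Polynomial.C (eval s E)⁻¹ * a.map (eval s), Polynomial.C (eval s E)⁻¹ * b.map (eval s), ?_⟩
    rw [mul_assoc, mul_assoc, ← mul_add, h5, ← Polynomial.C_mul,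
      inv_mul_cancel₀ (left_ne_zero_of_mul hs), Polynomial.C_1]
  refine ⟨q.roots.toFinset, ?_, fun x hx => ?_⟩
  · rw [Multiset.toFinset_card_of_nodup (Polynomial.nodup_roots hsep), ← hqd]
    exact ((IsAlgClosed.splits q).natDegree_eq_card_roots).symm
  · rw [Multiset.mem_toFinset, Polynomial.mem_roots hqm.ne_zero, Polynomial.IsRoot.def] at hx
    refine ⟨by rw [eval_eq_eval_mv_eval', hx], fun h => ?_⟩
    have h6 := congrArg (fun z => Polynomial.eval x (Polynomial.map (eval s) z)) h4
    simp only [Polynomial.map_add, Polynomial.map_mul, Polynomial.eval_add, Polynomial.eval_mul,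
      Polynomial.map_C, Polynomial.eval_C] at h6
    rw [← hq, hx, ← eval_eq_eval_mv_eval', eval_restr] at h6
    change _ + _ * eval (cc e (Fin.cons x s)) F = _ at h6
    rw [h, mul_zero, mul_zero, add_zero] at h6
    exact right_ne_zero_of_mul hs h6.symm

theorem Pt_zero (D : Dat n d F e fh u v) (N : ℕ) (hN : N < n * d)
    (r : ℕ × ℕ → MvPolynomial (Fin 4) ℂ)
    (hres : ∀ y, eval y fh = 0 →
     Polynomial.resultant (LL F e (fun j => (C (y j) : MvPolynomial (Fin 4) ℂ)) X)
      (PT N r (C (y 1)) (C (y 2))) n N = 0) (s : Fin 2 → ℂ) (A : Finset ℂ) (hA : A.card = d)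
    (hAx : ∀ x ∈ A, eval (Fin.cons x s) fh = 0 ∧ eval (cc e (Fin.cons x s)) F ≠ 0) :
    Pt N r (s 0) (s 1) = 0 := by
  have h1 : ∏ x ∈ A, Gt F (cc e (Fin.cons x s)) ∣ Pt N r (s 0) (s 1) := by
    apply Finset.prod_dvd_of_isRelPrime
    · intro x hx x' hx' hxx
      exact D.Gt_relprime s x x' hxx
    · intro x hx
      exact Gt_dvd_Pt D.hF D.hFirr N r (Fin.cons x s) (hres _ (hAx x hx).1) (hAx x hx).2
  by_contra h0
  have h2 := Polynomial.natDegree_le_of_dvd h1 h0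
  rw [Polynomial.natDegree_prod _ _ (fun x _ => (Gt_prime D.hFirr _).ne_zero),
    Finset.sum_congr rfl (fun x hx => Gt_natDegree D.hF _ (hAx x hx).2), Finset.sum_const, hA,
    smul_eq_mul] at h2
  have := Pt_deg N r (s 0) (s 1)
  rw [mul_comm] at h2
  omega

theorem r_zero (N : ℕ) (r : ℕ × ℕ → MvPolynomial (Fin 4) ℂ) (M : MvPolynomial (Fin 2) ℂ) (hM : M ≠ 0)
    (h : ∀ s, eval s M ≠ 0 → Pt N r (s 0) (s 1) = 0) (a : ℕ × ℕ) (ha : a ∈ JJ N) : r a = 0 := by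
  apply MvPolynomial.funext
  intro p0
  rw [map_zero]
  let m : ℕ × ℕ → (Fin 2 →₀ ℕ) := fun b => Finsupp.single 0 (N - b.1 - b.2) + Finsupp.single 1 b.1
  let Z : MvPolynomial (Fin 2) ℂ := ∑ b ∈ JJ N, if b.2 = a.2 then monomial (m b) (eval p0 (r b)) else 0
  have hZM : Z * M = 0 := by
    apply MvPolynomial.funext
    intro s
    rw [map_mul, map_zero]
    by_cases hs : eval s M = 0
    · rw [hs, mul_zero]
    have h1 := congrArg (fun z => eval p0 (Polynomial.coeff z (N - a.2))) (h s hs)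
    simp only [Pt, Polynomial.finsetSum_coeff, map_sum, Polynomial.coeff_zero, map_zero] at h1
    have h2 : eval s Z = 0 := by
      rw [← h1, map_sum]
      refine Finset.sum_congr rfl fun b hb => ?_
      rw [Polynomial.coeff_C_mul, Polynomial.coeff_X_pow]
      have hb' := mem_JJ.1 hb
      have ha' := mem_JJ.1 ha
      by_cases hba : b.2 = a.2
      · rw [if_pos hba, if_pos (by omega), mul_one, map_mul, eval_C, eval_monomial]
        congr 1
        rw [Finsupp.prod_add_index' (by simp) (by simp [pow_add]), Finsupp.prod_single_index (by simp),
          Finsupp.prod_single_index (by simp)]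
      · rw [if_neg hba, if_neg (by omega), mul_zero, map_zero, map_zero]
    rw [h2, zero_mul]
  have hZ : Z = 0 := (mul_eq_zero.1 hZM).resolve_right hM
  have h3 := congrArg (coeff (m a)) hZ
  rw [coeff_sum, Finset.sum_eq_single a] at h3
  · simpa using h3
  · intro b hb hba
    by_cases h4 : b.2 = a.2
    · rw [if_pos h4, coeff_monomial, if_neg]
      intro h5
      apply hba
      have := DFunLike.congr_fun h5 1
      simp [m] at this
      exact Prod.ext this h4
    · rw [if_neg h4, coeff_zero]
  · intro h; exact absurd ha h

theorem indep_S (D : Dat n d F e fh u v) (H0 : MvPolynomial (Fin 4) ℂ) (hH0 : H0 ≠ 0)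
    {R : Type*} [CommRing R] [Algebra ℂ R] [Algebra (MvPolynomial (Fin 4) ℂ) R]
    [IsScalarTower ℂ (MvPolynomial (Fin 4) ℂ) R] [IsLocalization.Away H0 R]
    (t0 : PowerSeries R)
    (ht : aeval (fun i => qR R e u v i + t0 * PowerSeries.C (algebraMap (MvPolynomial (Fin 4) ℂ) R (X i))) F = 0)
    (N : ℕ) (hN : N < n * d) (r : ℕ × ℕ → MvPolynomial (Fin 4) ℂ)
    (hr : ∑ a ∈ JJ N, PowerSeries.C (algebraMap (MvPolynomial (Fin 4) ℂ) R (r a)) *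
      (PowerSeries.map (algebraMap ℂ R) u ^ a.1 * t0 ^ a.2) = 0) (a : ℕ × ℕ) (ha : a ∈ JJ N) : r a = 0 := by
  obtain ⟨M, hM, h⟩ := D.good_open
  refine r_zero N r M hM (fun s hs => ?_) a ha
  obtain ⟨A, hA, hAx⟩ := h s hs
  exact D.Pt_zero N hN r (fun y hy => D.res_zero H0 hH0 t0 ht N r hr y hy) s A hA hAx

/-- generic independence over the localization -/
theorem indep_R (D : Dat n d F e fh u v) (H0 : MvPolynomial (Fin 4) ℂ) (hH0 : H0 ≠ 0)
    {R : Type*} [CommRing R] [Algebra ℂ R] [Algebra (MvPolynomial (Fin 4) ℂ) R]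
    [IsScalarTower ℂ (MvPolynomial (Fin 4) ℂ) R] [IsLocalization.Away H0 R]
    (t0 : PowerSeries R)
    (ht : aeval (fun i => qR R e u v i + t0 * PowerSeries.C (algebraMap (MvPolynomial (Fin 4) ℂ) R (X i))) F = 0)
    (N : ℕ) (hN : N < n * d) (r : {a // a ∈ JJ N} → R)
    (hr : ∑ a, PowerSeries.C (r a) *
      (PowerSeries.map (algebraMap ℂ R) u ^ a.1.1 * t0 ^ a.1.2) = 0) : r = 0 := by
  obtain ⟨b, hb⟩ := IsLocalization.exist_integer_multiples_of_finite (Submonoid.powers H0) r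
  have hunit := IsLocalization.map_units R b
  choose r' hr' using hb
  let r2 : ℕ × ℕ → MvPolynomial (Fin 4) ℂ := fun a => if h : a ∈ JJ N then r' ⟨a, h⟩ else 0
  have h1 : ∑ a ∈ JJ N, PowerSeries.C (algebraMap (MvPolynomial (Fin 4) ℂ) R (r2 a)) *
      (PowerSeries.map (algebraMap ℂ R) u ^ a.1 * t0 ^ a.2) = 0 := by
    rw [← Finset.sum_coe_sort]
    have h := congrArg (PowerSeries.C (algebraMap (MvPolynomial (Fin 4) ℂ) R b) * ·) hr
    simp only [mul_zero, Finset.mul_sum] at h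
    rw [← h]
    refine Finset.sum_congr rfl fun a _ => ?_
    have : r2 a = r' a := by simp only [r2]; rw [dif_pos a.2]
    rw [this, hr', Algebra.smul_def, map_mul, mul_assoc]
  funext a
  have h2 := D.indep_S H0 hH0 t0 ht N hN r2 h1 a a.2
  have h3 : r2 a = r' a := by simp only [r2]; rw [dif_pos a.2]
  have h4 := hr' a
  rw [← h3, h2, map_zero, Algebra.smul_def] at h4
  exact hunit.mul_right_eq_zero.1 h4.symm
end Dat
end
end

section
section
open MvPolynomial
namespace Dat
variable {n d : ℕ} {F : MvPolynomial (Fin 4) ℂ} {e : Fin 3 → Fin 4 → ℂ}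
    {fh : MvPolynomial (Fin 3) ℂ} {u v : PowerSeries ℂ}

theorem qR_map {R : Type*} [CommRing R] [Algebra ℂ R] (φ : R →+* ℂ)
    (hφ : φ.comp (algebraMap ℂ R) = RingHom.id ℂ) (i : Fin 4) :
    PowerSeries.map φ (qR R e u v i) = qR ℂ e u v i := by
  have hφ2 : ∀ c, φ (algebraMap ℂ R c) = c := fun c => RingHom.congr_fun hφ c
  simp only [qR, map_sum, map_mul, PowerSeries.map_C, hφ2]
  refine Finset.sum_congr rfl fun j _ => ?_
  rw [← RingHom.comp_apply (PowerSeries.map φ), ← PowerSeries.map_comp, hφ]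
  rfl

theorem claimA (D : Dat n d F e fh u v) (N : ℕ) (hN : N < n * d) :
    ∃ H : MvPolynomial (Fin 4) ℂ, H ≠ 0 ∧ ∀ p, eval p H ≠ 0 → eval p F ≠ 0 ∧
      ∃ t : PowerSeries ℂ,
        aeval (fun i => qR ℂ e u v i + t * PowerSeries.C (p i)) F = 0 ∧
        ∀ a : {a // a ∈ JJ N} → ℂ, ∑ b, PowerSeries.C (a b) * (u ^ b.1.1 * t ^ b.1.2) = 0 → a = 0 := by
  let δ : MvPolynomial (Fin 4) ℂ := ∑ i, C (eval (e 1) (pderiv i F)) * X i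
  have hδ : δ ≠ 0 := by
    obtain ⟨i, hi⟩ := D.hsm
    intro h
    apply hi
    have := congrArg (eval (Pi.single i 1)) h
    simpa [δ, Pi.single_apply] using this
  obtain ⟨H0, hH0⟩ : ∃ H0, H0 = δ * F := ⟨_, rfl⟩
  have hH0' : H0 ≠ 0 := hH0 ▸ mul_ne_zero hδ D.hFirr.ne_zero
  let R := Localization.Away H0
  have hU : IsUnit (algebraMap (MvPolynomial (Fin 4) ℂ) R H0) := IsLocalization.Away.algebraMap_isUnit H0
  have hU2 : algebraMap (MvPolynomial (Fin 4) ℂ) R H0 = algebraMap _ R δ * algebraMap _ R F := by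
    rw [← map_mul, ← hH0]
  rw [hU2, IsUnit.mul_iff] at hU
  have hCR : ∀ c, algebraMap (MvPolynomial (Fin 4) ℂ) R (algebraMap ℂ _ c) = algebraMap ℂ R c :=
    fun c => (IsScalarTower.algebraMap_apply ℂ (MvPolynomial (Fin 4) ℂ) R c).symm
  obtain ⟨t0, -, ht0⟩ := D.hens_gen (R := R) (fun i => algebraMap (MvPolynomial (Fin 4) ℂ) R (X i))
    (by
      rw [← hom_aeval (algebraMap (MvPolynomial (Fin 4) ℂ) R) hCR]
      have : aeval (fun i => (X i : MvPolynomial (Fin 4) ℂ)) F = F := aeval_X_left_apply F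
      rw [this]
      exact hU.2)
    (by
      have h1 : algebraMap _ R δ = ∑ i, algebraMap ℂ R (eval (e 1) (pderiv i F)) *
          algebraMap (MvPolynomial (Fin 4) ℂ) R (X i) := by
        rw [map_sum]
        refine Finset.sum_congr rfl fun i _ => ?_
        rw [← hCR, map_mul]
        rfl
      rw [← h1]
      exact hU.1)
  have : IsDomain R := IsLocalization.isDomain_localization (powers_le_nonZeroDivisors_of_noZeroDivisors hH0')
  obtain ⟨h, hh, hmin⟩ := minors (R := R) (fun a : {a // a ∈ JJ N} => (PowerSeries.map (algebraMap ℂ R) u ^ a.1.1 * t0 ^ a.1.2))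
    (fun r hr => D.indep_R H0 hH0' t0 ht0 N hN r hr)
  obtain ⟨⟨nu, b⟩, hnu⟩ := IsLocalization.surj (Submonoid.powers H0) h
  have hnu0 : nu ≠ 0 := by
    rintro rfl
    simp only [map_zero] at hnu
    exact hh ((IsLocalization.map_units R b).mul_left_eq_zero.1 hnu)
  refine ⟨nu * H0, mul_ne_zero hnu0 hH0', fun p hp => ?_⟩
  rw [map_mul] at hp
  have hpH := right_ne_zero_of_mul hp
  let φ : R →+* ℂ := IsLocalization.Away.lift (S := R) H0 (g := eval p) (isUnit_iff_ne_zero.2 hpH)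
  have hφ : φ.comp (algebraMap (MvPolynomial (Fin 4) ℂ) R) = eval p :=
      IsLocalization.Away.lift_comp H0 _
  have hφs : ∀ x, φ (algebraMap (MvPolynomial (Fin 4) ℂ) R x) = eval p x := fun x => RingHom.congr_fun hφ x
  have hφ' : φ.comp (algebraMap ℂ R) = RingHom.id ℂ := by
      rw [IsScalarTower.algebraMap_eq ℂ (MvPolynomial (Fin 4) ℂ) R, ← RingHom.comp_assoc, hφ]
      ext c <;> simp
  have hφh : φ h ≠ 0 := by
    intro h0
    have := congrArg φ hnu
    rw [map_mul, h0, zero_mul, hφs] at this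
    exact left_ne_zero_of_mul hp this.symm
  have hmap : PowerSeries.map φ (PowerSeries.map (algebraMap ℂ R) u) = u := by
    rw [← RingHom.comp_apply (PowerSeries.map φ), ← PowerSeries.map_comp, hφ']
    rfl
  refine ⟨?_, PowerSeries.map φ t0, ?_, ?_⟩
  · rw [hH0, map_mul] at hpH
    exact right_ne_zero_of_mul hpH
  · have h1 := congrArg (PowerSeries.map φ) ht0
    rw [hom_aeval, map_zero] at h1
    · simp only [map_add, map_mul, qR_map φ hφ', PowerSeries.map_C, hφs, eval_X] at h1
      exact h1
    · intro c
      rw [PowerSeries.algebraMap_apply, PowerSeries.map_C, PowerSeries.algebraMap_apply]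
      congr 1
      exact RingHom.congr_fun hφ' c
  · intro a ha
    apply hmin φ hφh a
    rw [← ha]
    refine Finset.sum_congr rfl fun b _ => ?_
    rw [map_mul, map_pow, map_pow, hmap]
end Dat
end
end

section
section
open MvPolynomial
namespace Dat

theorem indep_poly (N : ℕ) (u t : PowerSeries ℂ)
    (hind : ∀ a : {a // a ∈ JJ N} → ℂ, ∑ b, PowerSeries.C (a b) * (u ^ b.1.1 * t ^ b.1.2) = 0 → a = 0)
    (Φ : ℕ → Polynomial ℂ) (hdeg : ∀ i, i ≤ N → (Φ i).natDegree ≤ N - i)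
    (h : ∑ i ∈ Finset.range (N+1), Polynomial.aeval u (Φ i) * t ^ i = 0) (i : ℕ) (hi : i ≤ N) :
    Φ i = 0 := by
  have h1 := hind (fun b => (Φ b.1.2).coeff b.1.1) (by
    rw [Finset.sum_coe_sort (JJ N) (fun b => PowerSeries.C ((Φ b.2).coeff b.1) * (u ^ b.1 * t ^ b.2)),
      JJ, Finset.sum_filter, Finset.sum_product_right]
    refine Eq.trans (Finset.sum_congr rfl fun i hi => ?_) h
    have hi' : i ≤ N := by simpa [Nat.lt_succ_iff] using hi
    rw [Polynomial.aeval_eq_sum_range' (lt_of_le_of_lt (hdeg i hi') (by omega : N - i < N + 1)),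
      Finset.sum_mul]
    refine Finset.sum_congr rfl fun j hj => ?_
    simp only
    split_ifs with hij
    · rw [Algebra.smul_def, PowerSeries.algebraMap_apply, mul_assoc]
      rfl
    · rw [Polynomial.coeff_eq_zero_of_natDegree_lt (lt_of_le_of_lt (hdeg i hi') (by omega)), zero_smul,
        zero_mul])
  ext j
  rw [Polynomial.coeff_zero]
  by_cases hj : j + i ≤ N
  · exact congrFun h1 ⟨(j, i), mem_JJ.2 hj⟩
  · exact Polynomial.coeff_eq_zero_of_natDegree_lt (lt_of_le_of_lt (hdeg i hi) (by omega))

/-- the base map -/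
noncomputable def bet (u : PowerSeries ℂ) : MvPolynomial (Fin 2) ℂ →ₐ[ℂ] Polynomial (PowerSeries ℂ) :=
  aeval (fun i => Polynomial.X * Polynomial.C ((![1, u] : Fin 2 → PowerSeries ℂ) i))

theorem no_monic (N : ℕ) (u t : PowerSeries ℂ)
    (hind : ∀ a : {a // a ∈ JJ N} → ℂ, ∑ b, PowerSeries.C (a b) * (u ^ b.1.1 * t ^ b.1.2) = 0 → a = 0)
    (m : Polynomial (MvPolynomial (Fin 2) ℂ)) (hm : m.Monic) (hmN : m.natDegree ≤ N)
    (h : Polynomial.eval₂ (bet u).toRingHom (Polynomial.X * Polynomial.C t) m = 0) : False := by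
  set r0 := m.natDegree with hr0
  let Φ : ℕ → Polynomial ℂ := fun i => if i ≤ r0 then
    aeval (![1, Polynomial.X] : Fin 2 → Polynomial ℂ) (homogeneousComponent (r0 - i) (m.coeff i)) else 0
  have h1 := indep_poly N u t hind Φ (by
    intro i hi
    simp only [Φ]
    split_ifs with hir
    · have := MvPolynomial.aeval_natDegree_le (homogeneousComponent (r0 - i) (m.coeff i))
        (homogeneousComponent_isHomogeneous _ _).totalDegree_le
        (![1, Polynomial.X] : Fin 2 → Polynomial ℂ) (n := 1) (by
          intro j; fin_cases j <;> simp)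
      omega
    · simp) (by
    have h2 := congrArg (fun z => Polynomial.coeff z r0) h
    simp only [Polynomial.coeff_zero] at h2
    rw [Polynomial.eval₂_eq_sum_range' _ (lt_of_le_of_lt hmN (Nat.lt_succ_self N)),
      Polynomial.finsetSum_coeff] at h2
    rw [← h2]
    refine Finset.sum_congr rfl fun i _ => ?_
    rw [mul_pow, mul_left_comm, ← Polynomial.C_pow, mul_comm (Polynomial.X ^ i), Polynomial.coeff_mul_X_pow',
      Polynomial.coeff_mul_C]
    simp only [Φ]
    split_ifs with hir
    · congr 1
      change _ = Polynomial.coeff (bet u (m.coeff i)) _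
      rw [bet, coeff_aeval_lam, ← AlgHom.comp_apply, comp_aeval]
      congr 2
      ext1 j
      fin_cases j <;> simp
    · simp) r0 hmN
  simp only [Φ, le_refl, if_true, Nat.sub_self] at h1
  rw [hr0, hm.coeff_natDegree, homogeneousComponent_of_mem (n := 0) (isHomogeneous_one _ _)] at h1
  simp at h1
end Dat
end
end

section
theorem deg_tower {E K Λ : Type*} [Field E] [Field K] [Field Λ] [Algebra E K] [Algebra K Λ]
    [Algebra E Λ] [IsScalarTower E K Λ] [FiniteDimensional E K] (T : Λ) (hTK : IsIntegral K T) :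
    (minpoly E T).natDegree ≤ Module.finrank E K * (minpoly K T).natDegree := by
  let K' := IntermediateField.adjoin K {T}
  let gT : K' := IntermediateField.AdjoinSimple.gen K T
  have hgT : algebraMap K' Λ gT = T := IntermediateField.AdjoinSimple.algebraMap_gen K T
  have : FiniteDimensional K K' := IntermediateField.adjoin.finiteDimensional hTK
  have : FiniteDimensional E K' := FiniteDimensional.trans E K K'
  have : IsScalarTower E K' Λ := IsScalarTower.of_algebraMap_eq fun x => by
    rw [IsScalarTower.algebraMap_apply E K Λ, IsScalarTower.algebraMap_apply E K K']
    rfl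
  have h6 : (minpoly E gT).natDegree ≤ Module.finrank E K' := minpoly.natDegree_le gT
  rw [← minpoly.algebraMap_eq (algebraMap K' Λ).injective gT, hgT, ← Module.finrank_mul_finrank E K K',
    IntermediateField.adjoin.finrank hTK] at h6
  exact h6

/-- abstract degree bound -/
theorem deg_bound {B Λ E : Type*} [CommRing B] [IsDomain B] [IsIntegrallyClosed B] [Field Λ] [Field E]
    [Algebra B E] [IsFractionRing B E] [Algebra B Λ] [Algebra E Λ] [IsScalarTower B E Λ]
    (V T : Λ) (hT : IsIntegral B T) (n d : ℕ) (hn : 0 < n) (hd : 0 < d)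
    (f : Polynomial B) (hf : f.Monic) (hfd : f.natDegree = d) (hV : Polynomial.aeval V f = 0)
    (Q : Polynomial (Polynomial B)) (hQ : Q.natDegree < n)
    (hQ0 : Q.map (Polynomial.aeval V : Polynomial B →ₐ[B] Λ).toRingHom ≠ 0)
    (hQT : Q.eval₂ (Polynomial.aeval V : Polynomial B →ₐ[B] Λ).toRingHom T = 0) :
    ∃ m : Polynomial B, m.Monic ∧ m.natDegree < n * d ∧ Polynomial.aeval T m = 0 := by
  refine ⟨minpoly B T, minpoly.monic hT, ?_, minpoly.aeval _ _⟩
  have h1 : (minpoly E T).natDegree = (minpoly B T).natDegree := by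
    rw [minpoly.isIntegrallyClosed_eq_field_fractions' E hT, (minpoly.monic hT).natDegree_map]
  rw [← h1]
  have hfE : Polynomial.aeval V (f.map (algebraMap B E)) = 0 := by
    rw [Polynomial.aeval_map_algebraMap, hV]
  have hVi : IsIntegral E V := ⟨f.map (algebraMap B E), hf.map _, hfE⟩
  have hVd : (minpoly E V).natDegree ≤ d := by
    rw [← hfd, ← hf.natDegree_map (algebraMap B E)]
    exact Polynomial.natDegree_le_of_dvd (minpoly.dvd E V hfE) (hf.map _).ne_zero
  let K := IntermediateField.adjoin E {V}
  let gV : K := IntermediateField.AdjoinSimple.gen E V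
  have hgV : algebraMap K Λ gV = V := IntermediateField.AdjoinSimple.algebraMap_gen E V
  have : FiniteDimensional E K := IntermediateField.adjoin.finiteDimensional hVi
  have hK : Module.finrank E K ≤ d := by
    rw [IntermediateField.adjoin.finrank hVi]; exact hVd
  have hTE : IsIntegral E T := hT.tower_top
  have hTK : IsIntegral K T := hTE.tower_top
  let ψ : Polynomial B →+* K := Polynomial.eval₂RingHom ((algebraMap E K).comp (algebraMap B E)) gV
  have hψ : (algebraMap K Λ).comp ψ = (Polynomial.aeval V : Polynomial B →ₐ[B] Λ).toRingHom := by
    apply Polynomial.ringHom_ext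
    · intro b
      simp only [ψ, RingHom.comp_apply, Polynomial.coe_eval₂RingHom, Polynomial.eval₂_C]
      rw [← IsScalarTower.algebraMap_apply E K Λ, ← IsScalarTower.algebraMap_apply B E Λ]
      simp
    · simp only [ψ, RingHom.comp_apply, Polynomial.coe_eval₂RingHom, Polynomial.eval₂_X, hgV]
      simp
  have hq : (minpoly K T).natDegree < n := by
    have h2 : Q.map ψ ≠ 0 := by
      intro h
      apply hQ0
      rw [← hψ, ← Polynomial.map_map, h, Polynomial.map_zero]
    have h3 : Polynomial.aeval T (Q.map ψ) = 0 := by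
      rw [Polynomial.aeval_def, Polynomial.eval₂_map, hψ, hQT]
    have h4 := Polynomial.natDegree_le_of_dvd (minpoly.dvd K T h3) h2
    have h5 := Polynomial.natDegree_map_le (f := ψ) (p := Q)
    omega
  have h6 := deg_tower (E := E) (K := K) T hTK
  calc _ ≤ _ := h6
    _ ≤ d * (minpoly K T).natDegree := Nat.mul_le_mul_right _ hK
    _ < d * n := Nat.mul_lt_mul_of_pos_left hq hd
    _ = n * d := mul_comm _ _
end

section
theorem integral_step {B Λ : Type*} [CommRing B] [Field Λ] [Algebra B Λ]
    (V T : Λ) (f : Polynomial B) (hf : f.Monic) (hV : Polynomial.aeval V f = 0)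
    (G : Polynomial (Polynomial B)) (hG : G.Monic)
    (hGT : G.eval₂ (Polynomial.aeval V : Polynomial B →ₐ[B] Λ).toRingHom T = 0) : IsIntegral B T := by
  have hVi : IsIntegral B V := ⟨f, hf, hV⟩
  let A := integralClosure B Λ
  let Va : A := ⟨V, hVi⟩
  let ψ : Polynomial B →ₐ[B] A := Polynomial.aeval Va
  have h1 : (algebraMap A Λ).comp ψ.toRingHom = (Polynomial.aeval V : Polynomial B →ₐ[B] Λ).toRingHom := by
    apply Polynomial.ringHom_ext
    · intro b
      simp [ψ]
    · simp [ψ]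
      rfl
  have h2 : IsIntegral A T := ⟨G.map ψ.toRingHom, hG.map _, by
    rw [Polynomial.eval₂_map, h1, hGT]⟩
  exact isIntegral_trans T h2

theorem deg_bound2 {B Λ : Type*} [CommRing B] [IsDomain B] [IsIntegrallyClosed B] [Field Λ]
    (β : B →+* Λ) (hβ : Function.Injective β)
    (V T : Λ) (n d : ℕ) (hn : 0 < n) (hd : 0 < d)
    (f : Polynomial B) (hf : f.Monic) (hfd : f.natDegree = d) (hV : f.eval₂ β V = 0)
    (G : Polynomial (Polynomial B)) (hG : G.Monic)
    (hGT : G.eval₂ (Polynomial.eval₂RingHom β V) T = 0)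
    (Q : Polynomial (Polynomial B)) (hQ : Q.natDegree < n)
    (hQ0 : Q.map (Polynomial.eval₂RingHom β V) ≠ 0)
    (hQT : Q.eval₂ (Polynomial.eval₂RingHom β V) T = 0) :
    ∃ m : Polynomial B, m.Monic ∧ m.natDegree < n * d ∧ m.eval₂ β T = 0 := by
  let _ : Algebra B Λ := β.toAlgebra
  let _ : Algebra (FractionRing B) Λ := (IsFractionRing.lift (K := FractionRing B) hβ).toAlgebra
  have : IsScalarTower B (FractionRing B) Λ := IsScalarTower.of_algebraMap_eq fun x =>
    (IsFractionRing.lift_algebraMap (K := FractionRing B) hβ x).symm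
  exact deg_bound (E := FractionRing B) V T (integral_step V T f hf hV G hG hGT) n d hn hd f hf hfd hV Q hQ hQ0 hQT

section
open MvPolynomial
namespace Dat
variable {n d : ℕ} {F : MvPolynomial (Fin 4) ℂ} {e : Fin 3 → Fin 4 → ℂ}
    {fh : MvPolynomial (Fin 3) ℂ} {u v : PowerSeries ℂ}

theorem fptR_eq : fptR ℂ u v = fpt u v := by
  funext j
  rw [fptR, fpt]
  congr 2

/-- the equation of the cone section, over the coordinate ring of the plane -/
noncomputable def GG (F : MvPolynomial (Fin 4) ℂ) (e : Fin 3 → Fin 4 → ℂ) (p : Fin 4 → ℂ) :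
    Polynomial (MvPolynomial (Fin 3) ℂ) :=
  Polynomial.C (C (eval p F)⁻¹) * LL F e (fun j => X j) (fun i => C (p i))

theorem GG_monic (hF : F.IsHomogeneous n) (p : Fin 4 → ℂ) (hp : eval p F ≠ 0) :
    (GG F e p).Monic ∧ (GG F e p).natDegree = n := by
  obtain ⟨h1, h2⟩ := lead_lin F n hF
    (fun i => ∑ j, algebraMap ℂ (MvPolynomial (Fin 3) ℂ) (e j i) * X j) (fun i => C (p i))
  change (LL F e (fun j => X j) (fun i => C (p i))).natDegree ≤ n at h1
  change (LL F e (fun j => X j) (fun i => C (p i))).coeff n = _ at h2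
  have h3 := hom_aeval (C : ℂ →+* MvPolynomial (Fin 3) ℂ) (fun c => rfl) p F
  rw [← h3, MvPolynomial.aeval_eq_eval] at h2
  have h4 : (GG F e p).natDegree ≤ n := (Polynomial.natDegree_C_mul_le _ _).trans h1
  have h5 : (GG F e p).coeff n = 1 := by
    rw [GG, Polynomial.coeff_C_mul, h2, ← C_mul, inv_mul_cancel₀ hp, C_1]
  exact ⟨Polynomial.monic_of_natDegree_le_of_coeff_eq_one n h4 h5,
    le_antisymm h4 (Polynomial.le_natDegree_of_ne_zero (by rw [h5]; exact one_ne_zero))⟩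

theorem GG_formal (hF : F.IsHomogeneous n) (p : Fin 4 → ℂ) (t : PowerSeries ℂ)
    (ht : aeval (fun i => qR ℂ e u v i + t * PowerSeries.C (p i)) F = 0) :
    (GG F e p).eval₂ (aeval (fpt u v) : MvPolynomial (Fin 3) ℂ →ₐ[ℂ] _).toRingHom
      (Polynomial.X * Polynomial.C t) = 0 := by
  set θ := (aeval (fpt u v) : MvPolynomial (Fin 3) ℂ →ₐ[ℂ] Polynomial (PowerSeries ℂ)).toRingHom with hθ
  have hX : ∀ j, θ (X j) = fpt u v j := fun j => aeval_X _ _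
  have hC : ∀ c, θ (C c) = Polynomial.C (PowerSeries.C c) := fun c => by
    have : θ (C c) = algebraMap ℂ (Polynomial (PowerSeries ℂ)) c := aeval_C _ _
    rw [this, Polynomial.algebraMap_apply, PowerSeries.algebraMap_apply]
    rfl
  have hC' : ∀ c, θ (algebraMap ℂ _ c) = algebraMap ℂ _ c := fun c => aeval_C _ _
  rw [GG, Polynomial.eval₂_mul, LL_eval₂ θ hC']
  simp only [hX, hC]
  have h := formal_zero (n := n) hF t p ht
  rw [fptR_eq] at h
  rw [h, mul_zero]

theorem bet_inj (D : Dat n d F e fh u v) : Function.Injective (bet u) := by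
  rw [injective_iff_map_eq_zero]
  intro g hg
  exact form2_inj u D.hu D.hu0 g hg

theorem claimC (D : Dat n d F e fh u v) (p : Fin 4 → ℂ) (hp : eval p F ≠ 0) (t : PowerSeries ℂ)
    (ht : aeval (fun i => qR ℂ e u v i + t * PowerSeries.C (p i)) F = 0)
    (N : ℕ) (hN : n * d - 1 ≤ N) (hind : ∀ a : {a // a ∈ JJ N} → ℂ,
      ∑ b, PowerSeries.C (a b) * (u ^ b.1.1 * t ^ b.1.2) = 0 → a = 0)
    (Q : Polynomial (MvPolynomial (Fin 3) ℂ)) (hQ : Q.natDegree < n)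
    (hQT : Q.eval₂ (aeval (fpt u v) : MvPolynomial (Fin 3) ℂ →ₐ[ℂ] _).toRingHom
      (Polynomial.X * Polynomial.C t) = 0) (k : ℕ) : aeval (fpt u v) (Q.coeff k) = 0 := by
  by_contra hk
  let ι := algebraMap (Polynomial (PowerSeries ℂ)) (FractionRing (Polynomial (PowerSeries ℂ)))
  have hι : Function.Injective ι := IsFractionRing.injective _ _
  let ε : MvPolynomial (Fin 3) ℂ →+* Polynomial (MvPolynomial (Fin 2) ℂ) :=
    (finSuccEquiv ℂ 2 : MvPolynomial (Fin 3) ℂ →ₐ[ℂ] Polynomial (MvPolynomial (Fin 2) ℂ)).toRingHom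
  let V := ι (Polynomial.X * Polynomial.C v)
  let T := ι (Polynomial.X * Polynomial.C t)
  let β := ι.comp (bet u).toRingHom
  have hε : (Polynomial.eval₂RingHom β V).comp ε =
      ι.comp (aeval (fpt u v) : MvPolynomial (Fin 3) ℂ →ₐ[ℂ] _).toRingHom := by
    refine RingHom.ext fun x => ?_
    change Polynomial.eval₂ β V (finSuccEquiv ℂ 2 x) = ι (aeval (fpt u v) x)
    rw [fpt_eq, aeval_fs, Polynomial.hom_eval₂]
    rfl
  obtain ⟨hm, hdeg⟩ := D.fs_monic
  have key : ∀ Q : Polynomial (MvPolynomial (Fin 3) ℂ), (Q.map ε).eval₂ (Polynomial.eval₂RingHom β V) T =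
      ι (Q.eval₂ (aeval (fpt u v) : MvPolynomial (Fin 3) ℂ →ₐ[ℂ] _).toRingHom
      (Polynomial.X * Polynomial.C t)) := by
    intro Q
    rw [Polynomial.eval₂_map, hε, Polynomial.hom_eval₂]
  obtain ⟨m, hmm, hmd, hmT⟩ := deg_bound2 β (hι.comp D.bet_inj) V T n d D.hn D.hd (finSuccEquiv ℂ 2 fh)
    hm hdeg (by
      have := congrArg ι D.fpt_fh
      rw [fpt_eq, aeval_fs, Polynomial.hom_eval₂, map_zero] at this
      exact this)
    ((GG F e p).map ε) ((GG_monic D.hF p hp).1.map _) (by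
      rw [key, GG_formal D.hF p t ht, map_zero])
    (Q.map ε) (lt_of_le_of_lt Polynomial.natDegree_map_le hQ) (by
      intro h
      apply hk
      rw [Polynomial.map_map, hε] at h
      have := congrArg (fun z => Polynomial.coeff z k) h
      simp only [Polynomial.coeff_map, Polynomial.coeff_zero] at this
      apply hι
      rw [map_zero]
      exact this)
    (by rw [key, hQT, map_zero])
  refine no_monic N u t hind m hmm (by omega) ?_
  apply hι
  rw [map_zero, Polynomial.hom_eval₂]
  exact hmT
end Dat
end
end

section
section
open MvPolynomial
namespace Dat
variable {n d : ℕ} {F : MvPolynomial (Fin 4) ℂ} {e : Fin 3 → Fin 4 → ℂ}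
    {fh : MvPolynomial (Fin 3) ℂ} {u v : PowerSeries ℂ}

/-- the formal point of the cone section -/
noncomputable def xh (e : Fin 3 → Fin 4 → ℂ) (u v t : PowerSeries ℂ) (p : Fin 4 → ℂ) (i : Fin 4) :
    Polynomial (PowerSeries ℂ) :=
  (∑ j, algebraMap ℂ (Polynomial (PowerSeries ℂ)) (e j i) * fpt u v j) +
    (Polynomial.X * Polynomial.C t) * Polynomial.C (PowerSeries.C (p i))

theorem LL_formal (g : MvPolynomial (Fin 4) ℂ) (p : Fin 4 → ℂ) (t : PowerSeries ℂ) :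
    (LL g e (fun j => X j) (fun i => C (p i))).eval₂
      (aeval (fpt u v) : MvPolynomial (Fin 3) ℂ →ₐ[ℂ] _).toRingHom
      (Polynomial.X * Polynomial.C t) = aeval (xh e u v t p) g := by
  set θ := (aeval (fpt u v) : MvPolynomial (Fin 3) ℂ →ₐ[ℂ] Polynomial (PowerSeries ℂ)).toRingHom with hθ
  have hX : ∀ j, θ (X j) = fpt u v j := fun j => aeval_X _ _
  have hC : ∀ c, θ (C c) = Polynomial.C (PowerSeries.C c) := fun c => by
    have : θ (C c) = algebraMap ℂ (Polynomial (PowerSeries ℂ)) c := aeval_C _ _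
    rw [this, Polynomial.algebraMap_apply, PowerSeries.algebraMap_apply]
    rfl
  have hC' : ∀ c, θ (algebraMap ℂ _ c) = algebraMap ℂ _ c := fun c => aeval_C _ _
  rw [LL_eval₂ θ hC']
  simp only [hX, hC]
  rfl

theorem LL_pt (g : MvPolynomial (Fin 4) ℂ) (p : Fin 4 → ℂ) (y : Fin 3 → ℂ) (s : ℂ) :
    (LL g e (fun j => X j) (fun i => C (p i))).eval₂ (eval y) s = eval (cc e y + s • p) g := by
  rw [LL_eval₂ (eval y) (fun c => by rw [MvPolynomial.algebraMap_eq, eval_C]; rfl),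
    MvPolynomial.aeval_eq_eval]
  congr 2
  funext i
  simp [cc, mul_comm]

theorem claimD (D : Dat n d F e fh u v) (p : Fin 4 → ℂ) (hp : eval p F ≠ 0) (t : PowerSeries ℂ)
    (ht : aeval (fun i => qR ℂ e u v i + t * PowerSeries.C (p i)) F = 0)
    (N : ℕ) (hN : n * d - 1 ≤ N) (hind : ∀ a : {a // a ∈ JJ N} → ℂ,
      ∑ b, PowerSeries.C (a b) * (u ^ b.1.1 * t ^ b.1.2) = 0 → a = 0)
    (g : MvPolynomial (Fin 4) ℂ) (hg : aeval (xh e u v t p) g = 0) (y : Fin 3 → ℂ) (s : ℂ)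
    (hy : eval y fh = 0) (hFx : eval (cc e y + s • p) F = 0) : eval (cc e y + s • p) g = 0 := by
  obtain ⟨hm, hdeg⟩ := GG_monic (e := e) D.hF p hp
  set Γ := LL g e (fun j => (X j : MvPolynomial (Fin 3) ℂ)) (fun i => C (p i)) with hΓ
  have hdiv := Polynomial.modByMonic_add_div Γ (GG F e p)
  have hr : (Γ %ₘ GG F e p).natDegree < n := by
    rw [← hdeg]
    apply Polynomial.natDegree_modByMonic_lt _ hm
    intro h
    rw [h, Polynomial.natDegree_one] at hdeg
    exact D.hn.ne hdeg
  have hrf := congrArg (Polynomial.eval₂ (aeval (fpt u v) : MvPolynomial (Fin 3) ℂ →ₐ[ℂ] _).toRingHom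
      (Polynomial.X * Polynomial.C t)) hdiv
  rw [Polynomial.eval₂_add, Polynomial.eval₂_mul, GG_formal D.hF p t ht, zero_mul, add_zero,
    hΓ, LL_formal, hg] at hrf
  have hco := D.claimC p hp t ht N hN hind _ hr hrf
  have hrp : (Γ %ₘ GG F e p).eval₂ (eval y) s = 0 := by
    rw [Polynomial.eval₂_eq_sum_range]
    refine Finset.sum_eq_zero fun k _ => ?_
    obtain ⟨b, hb⟩ := D.dvd_of_fpt _ (hco k)
    rw [hb, map_mul, hy, zero_mul, zero_mul]
  have h1 := congrArg (Polynomial.eval₂ (eval y) s) hdiv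
  rw [Polynomial.eval₂_add, Polynomial.eval₂_mul, hrp, GG, Polynomial.eval₂_mul, LL_pt, hFx, mul_zero,
    zero_mul, add_zero, hΓ, LL_pt] at h1
  exact h1.symm

/-- linear form with given coefficients -/
noncomputable def lin (a : Fin 4 → ℂ) : MvPolynomial (Fin 4) ℂ := ∑ i, C (a i) * X i

theorem eval_lin (a x : Fin 4 → ℂ) : eval x (lin a) = a ⬝ᵥ x := by
  simp [lin, dotProduct]

theorem aeval_lin (a : Fin 4 → ℂ) {A : Type*} [CommRing A] [Algebra ℂ A] (x : Fin 4 → A) :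
    aeval x (lin a) = ∑ i, algebraMap ℂ A (a i) * x i := by
  simp [lin]

theorem claimE (D : Dat n d F e fh u v) (p : Fin 4 → ℂ) (hp : eval p F ≠ 0) (t : PowerSeries ℂ)
    (ht : aeval (fun i => qR ℂ e u v i + t * PowerSeries.C (p i)) F = 0)
    (N : ℕ) (hN : n * d - 1 ≤ N) (hind : ∀ a : {a // a ∈ JJ N} → ℂ,
      ∑ b, PowerSeries.C (a b) * (u ^ b.1.1 * t ^ b.1.2) = 0 → a = 0)
    (l : Fin 3 → Fin 4 → ℂ) (hle : ∀ j k, l j ⬝ᵥ e k = if j = k then 1 else 0)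
    (hlp : ∀ j, l j ⬝ᵥ p = 0) (hrep : ∀ x, ∃ s : ℂ, x = cc e (fun j => l j ⬝ᵥ x) + s • p)
    (g1 g2 : MvPolynomial (Fin 4) ℂ)
    (hg : ∀ y (s : ℂ), eval y fh = 0 → eval (cc e y + s • p) F = 0 → y ≠ 0 →
      eval (cc e y + s • p) g1 * eval (cc e y + s • p) g2 = 0) :
    (∀ y (s : ℂ), eval y fh = 0 → eval (cc e y + s • p) F = 0 → eval (cc e y + s • p) g1 = 0) ∨
    (∀ y (s : ℂ), eval y fh = 0 → eval (cc e y + s • p) F = 0 → eval (cc e y + s • p) g2 = 0) := by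
  let fp : MvPolynomial (Fin 4) ℂ := aeval (fun j => lin (l j)) fh
  have hfp : ∀ x, eval x fp = eval (fun j => l j ⬝ᵥ x) fh := by
    intro x
    have := hom_aeval (eval x) (fun c => by rw [MvPolynomial.algebraMap_eq, eval_C]; rfl) (fun j => lin (l j)) fh
    simp only [eval_lin] at this
    rw [← MvPolynomial.aeval_eq_eval (fun j => l j ⬝ᵥ x)]
    exact this
  have hlx : ∀ j, aeval (xh e u v t p) (lin (l j)) = fpt u v j := by
    intro j
    rw [aeval_lin]
    simp only [xh, mul_add, Finset.sum_add_distrib, Finset.mul_sum]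
    rw [Finset.sum_comm]
    have h1 : ∀ k, ∑ i, algebraMap ℂ (Polynomial (PowerSeries ℂ)) (l j i) *
        (algebraMap ℂ (Polynomial (PowerSeries ℂ)) (e k i) * fpt u v k) =
        algebraMap ℂ (Polynomial (PowerSeries ℂ)) (l j ⬝ᵥ e k) * fpt u v k := by
      intro k
      rw [dotProduct, map_sum, Finset.sum_mul]
      exact Finset.sum_congr rfl fun i _ => by rw [map_mul, mul_assoc]
    have h2 : ∑ i, algebraMap ℂ (Polynomial (PowerSeries ℂ)) (l j i) *
        (Polynomial.X * Polynomial.C t * Polynomial.C (PowerSeries.C (p i))) =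
        algebraMap ℂ (Polynomial (PowerSeries ℂ)) (l j ⬝ᵥ p) * (Polynomial.X * Polynomial.C t) := by
      rw [dotProduct, map_sum, Finset.sum_mul]
      refine Finset.sum_congr rfl fun i _ => ?_
      have : algebraMap ℂ (Polynomial (PowerSeries ℂ)) (p i) = Polynomial.C (PowerSeries.C (p i)) := by
        rw [Polynomial.algebraMap_apply, PowerSeries.algebraMap_apply]; rfl
      rw [map_mul, this, mul_comm (Polynomial.X * Polynomial.C t), mul_assoc]
    rw [h2, hlp, map_zero, zero_mul, add_zero, Finset.sum_congr rfl (fun k _ => h1 k)]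
    simp only [hle]
    rw [Finset.sum_eq_single j]
    · simp
    · intro k _ hk
      rw [if_neg (Ne.symm hk), map_zero, zero_mul]
    · simp
  have hfx : aeval (xh e u v t p) fp = 0 := by
    have := hom_aeval (aeval (xh e u v t p) : MvPolynomial (Fin 4) ℂ →ₐ[ℂ] _).toRingHom
      (fun c => aeval_C _ _) (fun j => lin (l j)) fh
    change aeval (xh e u v t p) fp = aeval (fun i => aeval (xh e u v t p) (lin (l i))) fh at this
    rw [this]
    simp only [hlx]
    exact D.fpt_fh
  have hFxh : aeval (xh e u v t p) F = 0 := by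
    have := formal_zero (n := n) D.hF t p ht
    rw [fptR_eq] at this
    exact this
  let I : Ideal (MvPolynomial (Fin 4) ℂ) := Ideal.span {fp, F}
  let G := g1 * g2 * lin (l 1)
  have hG : G ∈ I.radical := by
    rw [← MvPolynomial.vanishingIdeal_zeroLocus_eq_radical (K := ℂ) I, MvPolynomial.mem_vanishingIdeal_iff]
    intro x hx
    have h1 : aeval x fp = 0 := hx fp (Ideal.subset_span (by simp))
    have h2 : aeval x F = 0 := hx F (Ideal.subset_span (by simp))
    rw [MvPolynomial.aeval_eq_eval] at h1 h2 ⊢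
    change eval x fp = 0 at h1
    change eval x F = 0 at h2
    change eval x (g1 * g2 * lin (l 1)) = 0
    rw [hfp] at h1
    obtain ⟨s, hs⟩ := hrep x
    rw [map_mul, map_mul, eval_lin]
    by_cases hy : (fun j => l j ⬝ᵥ x) = 0
    · have : l 1 ⬝ᵥ x = 0 := congrFun hy 1
      rw [this, mul_zero]
    · rw [hs] at h2
      have h3 := hg _ s h1 h2 hy
      rw [← hs] at h3
      rw [h3, zero_mul]
  obtain ⟨k, hk⟩ := hG
  have hker : I ≤ RingHom.ker (aeval (xh e u v t p) : MvPolynomial (Fin 4) ℂ →ₐ[ℂ] _) := by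
    rw [Ideal.span_le]
    rintro z (rfl | hz)
    · exact hfx
    · rw [Set.mem_singleton_iff.1 hz]; exact hFxh
  have h0 := hker hk
  rw [RingHom.mem_ker, map_pow] at h0
  have h1 := eq_zero_of_pow_eq_zero h0
  rw [map_mul, map_mul, hlx] at h1
  have h2 : fpt u v 1 ≠ 0 := by
    have : fpt u v 1 = Polynomial.X := by simp [fpt]
    rw [this]; exact Polynomial.X_ne_zero
  rcases mul_eq_zero.1 ((mul_eq_zero.1 h1).resolve_right h2) with h | h
  · left; intro y s hy hF; exact D.claimD p hp t ht N hN hind g1 h y s hy hF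
  · right; intro y s hy hF; exact D.claimD p hp t ht N hN hind g2 h y s hy hF
end Dat
end
end

section
open scoped LinearAlgebra.Projectivization
open Projectivization MvPolynomial
section

theorem mk_mem_zeroSet (f : MvPolynomial (Fin 4) ℂ) (m : ℕ) (hf : f.IsHomogeneous m)
    (v : Fin 4 → ℂ) (hv : v ≠ 0) : Projectivization.mk ℂ v hv ∈ zeroSet f ↔ MvPolynomial.eval v f = 0 := by
  change (∀ w ∈ Projectivization.submodule (Projectivization.mk ℂ v hv), MvPolynomial.eval w f = 0) ↔ _
  rw [Projectivization.submodule_mk]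
  constructor
  · intro h
    exact h v (Submodule.mem_span_singleton_self v)
  · intro h w hw
    obtain ⟨c, rfl⟩ := Submodule.mem_span_singleton.1 hw
    rw [homog_scale_eval f m hf, h, mul_zero]

theorem mk_mem_plane (W : Submodule ℂ (Fin 4 → ℂ)) (v : Fin 4 → ℂ) (hv : v ≠ 0) :
    Projectivization.mk ℂ v hv ∈ {x : P3 | Projectivization.submodule x ≤ W} ↔ v ∈ W := by
  change Projectivization.submodule (Projectivization.mk ℂ v hv) ≤ W ↔ _
  rw [Projectivization.submodule_mk, Submodule.span_singleton_le_iff_mem]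

theorem mk_mem_projSpan (x a b : Fin 4 → ℂ) (hx : x ≠ 0) (ha : a ≠ 0) (hb : b ≠ 0) :
    Projectivization.mk ℂ x hx ∈ projSpan (Projectivization.mk ℂ a ha) (Projectivization.mk ℂ b hb) ↔
      ∃ c d : ℂ, c • a + d • b = x := by
  change Projectivization.submodule (Projectivization.mk ℂ x hx) ≤ _ ↔ _
  rw [Projectivization.submodule_mk, Projectivization.submodule_mk, Projectivization.submodule_mk,
    Submodule.span_singleton_le_iff_mem, ← Submodule.span_union, Set.singleton_union,
    Submodule.mem_span_pair]

theorem irred_of (X : Set P3) (hne : X.Nonempty) (h : ∀ (g1 g2 : MvPolynomial (Fin 4) ℂ) (a b : ℕ),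
    g1.IsHomogeneous a → g2.IsHomogeneous b → X ⊆ zeroSet g1 ∪ zeroSet g2 →
    X ⊆ zeroSet g1 ∨ X ⊆ zeroSet g2) : IsIrredSet X := by
  refine ⟨hne, ?_⟩
  rintro Y Z ⟨S, hS, rfl⟩ ⟨S', hS', rfl⟩ hX
  by_contra hcon
  rw [not_or, Set.subset_iInter₂_iff, Set.subset_iInter₂_iff] at hcon
  push Not at hcon
  obtain ⟨⟨g1, hg1, h1⟩, ⟨g2, hg2, h2⟩⟩ := hcon
  obtain ⟨a, ha⟩ := hS g1 hg1
  obtain ⟨b, hb⟩ := hS' g2 hg2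
  have hsub : X ⊆ zeroSet g1 ∪ zeroSet g2 := by
    intro x hx
    rcases hX hx with hx | hx
    · left; exact Set.mem_iInter₂.1 hx g1 hg1
    · right; exact Set.mem_iInter₂.1 hx g2 hg2
  rcases h g1 g2 a b ha hb hsub with h | h
  · exact h1 h
  · exact h2 h

theorem isAlgClosed_zeroSet (g : MvPolynomial (Fin 4) ℂ) (a : ℕ) (hg : g.IsHomogeneous a) :
    IsAlgClosedSet (zeroSet g) := by
  refine ⟨{g}, ?_, ?_⟩
  · rintro _ rfl; exact ⟨a, hg⟩
  · simp

theorem irred_surface (n : ℕ) (F : MvPolynomial (Fin 4) ℂ) (hF : F.IsHomogeneous n)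
    (hirr : Irreducible F) (v0 : Fin 4 → ℂ) (hv0 : v0 ≠ 0) (hFv : MvPolynomial.eval v0 F = 0) :
    IsIrredSet (zeroSet F) := by
  refine irred_of _ ⟨Projectivization.mk ℂ v0 hv0, (mk_mem_zeroSet F n hF _ _).2 hFv⟩ ?_
  intro g1 g2 a b hg1 hg2 hsub
  have h1 : ∀ v, v ≠ 0 → MvPolynomial.eval v F = 0 → MvPolynomial.eval v (g1 * g2) = 0 := by
    intro v hv hFv
    rw [map_mul]
    rcases hsub ((mk_mem_zeroSet F n hF v hv).2 hFv) with h | h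
    · rw [(mk_mem_zeroSet g1 a hg1 v hv).1 h, zero_mul]
    · rw [(mk_mem_zeroSet g2 b hg2 v hv).1 h, mul_zero]
  have h2 : ∀ v, MvPolynomial.eval v F = 0 → MvPolynomial.eval v (g1 * g2) = 0 := by
    intro v hFv2
    by_cases hv : v = 0
    · have := homog_scale_eval (g1 * g2) _ (hg1.mul hg2) 0 v0
      rw [h1 v0 hv0 hFv, zero_smul, mul_zero] at this
      rw [hv, this]
    · exact h1 v hv hFv2
  have hp : Prime F := hirr.prime
  have h3 : g1 * g2 ∈ (Ideal.span {F}).radical := by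
    rw [← MvPolynomial.vanishingIdeal_zeroLocus_eq_radical (K := ℂ), MvPolynomial.mem_vanishingIdeal_iff]
    intro x hx
    have hx1 := hx F (Ideal.mem_span_singleton_self F)
    rw [MvPolynomial.aeval_eq_eval] at hx1 ⊢
    exact h2 x hx1
  obtain ⟨k, hk⟩ := h3
  have h4 := hp.dvd_of_dvd_pow (Ideal.mem_span_singleton.1 hk)
  have key : ∀ g (a : ℕ), g.IsHomogeneous a → F ∣ g → zeroSet F ⊆ zeroSet g := by
    intro g a hg ⟨q, hq⟩ x hx w hw
    rw [hq, map_mul, hx w hw, zero_mul]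
  rcases hp.dvd_or_dvd h4 with h | h
  · left; exact key g1 a hg1 h
  · right; exact key g2 b hg2 h

theorem frame (W : Submodule ℂ (Fin 4 → ℂ)) (hW : Module.finrank ℂ W = 3) (e : Fin 3 → Fin 4 → ℂ)
    (he : LinearIndependent ℂ e) (heW : ∀ j, e j ∈ W) :
    (∀ x, x ∈ W ↔ ∃ y, x = Dat.cc e y) ∧ ∀ p, p ∉ W → ∃ (l : Fin 3 → Fin 4 → ℂ) (α : Fin 4 → ℂ),
      (∀ j k, l j ⬝ᵥ e k = if j = k then 1 else 0) ∧ (∀ j, l j ⬝ᵥ p = 0) ∧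
      (∀ k, α ⬝ᵥ e k = 0) ∧ α ⬝ᵥ p = 1 ∧
      (∀ x, x = Dat.cc e (fun j => l j ⬝ᵥ x) + (α ⬝ᵥ x) • p) := by
  have hspan : Submodule.span ℂ (Set.range e) = W := by
    apply Submodule.eq_of_le_of_finrank_eq
    · rw [Submodule.span_le]; rintro _ ⟨j, rfl⟩; exact heW j
    · rw [finrank_span_eq_card he, hW]; rfl
  refine ⟨fun x => ?_, fun p hp => ?_⟩
  · rw [← hspan, Submodule.mem_span_range_iff_exists_fun]
    constructor
    · rintro ⟨c, hc⟩; exact ⟨c, hc.symm⟩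
    · rintro ⟨c, hc⟩; exact ⟨c, hc.symm⟩
  · have hli : LinearIndependent ℂ (Fin.cons p e : Fin 4 → Fin 4 → ℂ) :=
      linearIndependent_finCons.2 ⟨he, by rw [hspan]; exact hp⟩
    let B := basisOfLinearIndependentOfCardEqFinrank hli (by simp)
    have hB : ∀ i, B i = (Fin.cons p e : Fin 4 → Fin 4 → ℂ) i := fun i => by
      simp [B]
    let L : Fin 4 → Fin 4 → ℂ := fun k i => B.coord k (fun j => if i = j then 1 else 0)
    have hL : ∀ k x, L k ⬝ᵥ x = B.coord k x := by
      intro k x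
      conv_rhs => rw [LinearMap.pi_apply_eq_sum_univ (B.coord k) x]
      rw [dotProduct]
      exact Finset.sum_congr rfl fun i _ => by rw [smul_eq_mul, mul_comm]
    have hB0 : B 0 = p := hB 0
    have hBs : ∀ j : Fin 3, B j.succ = e j := fun j => hB j.succ
    refine ⟨fun j => L j.succ, L 0, ?_, ?_, ?_, ?_, ?_⟩
    · intro j k
      rw [hL, ← hBs, Module.Basis.coord_apply, Module.Basis.repr_self, Finsupp.single_apply]
      simp [eq_comm]
    · intro j
      rw [hL, ← hB0, Module.Basis.coord_apply, Module.Basis.repr_self, Finsupp.single_apply]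
      simp [eq_comm]
    · intro k
      rw [hL, ← hBs, Module.Basis.coord_apply, Module.Basis.repr_self, Finsupp.single_apply]
      simp
    · rw [hL, ← hB0, Module.Basis.coord_apply, Module.Basis.repr_self, Finsupp.single_apply]
      simp
    · intro x
      have := B.sum_repr x
      rw [Fin.sum_univ_succ, hB0] at this
      conv_lhs => rw [← this]
      rw [add_comm, Dat.cc]
      simp only [hL, hBs]
      rfl
end
end

section
open scoped LinearAlgebra.Projectivization
open Projectivization MvPolynomial
section

theorem exists_eval_ne {σ : Type*} (H : MvPolynomial σ ℂ) (h : H ≠ 0) :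
    ∃ v, MvPolynomial.eval v H ≠ 0 := by
  by_contra hcon
  push Not at hcon
  exact h (MvPolynomial.funext fun x => by rw [hcon x, map_zero])

theorem arc_of (fh : MvPolynomial (Fin 3) ℂ) (d : ℕ) (hfh : fh.IsHomogeneous d)
    (h1 : MvPolynomial.eval ![1, 0, 0] fh = 1) (h0 : MvPolynomial.eval ![0, 1, 0] fh = 0) :
    ∃ u v : PowerSeries ℂ, PowerSeries.constantCoeff u = 0 ∧ PowerSeries.constantCoeff v = 0 ∧
      u ≠ 0 ∧ MvPolynomial.aeval ![v, 1, u] fh = 0 := by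
  let a : Fin 3 → Polynomial ℂ := ![0, 1, Polynomial.X]
  let b : Fin 3 → Polynomial ℂ := ![1, 0, 0]
  let m : Polynomial (Polynomial ℂ) :=
    MvPolynomial.aeval (fun i => Polynomial.C (a i) + Polynomial.X * Polynomial.C (b i)) fh
  obtain ⟨hdeg, hco⟩ := lead_lin fh d hfh a b
  have hb : MvPolynomial.aeval b fh = 1 := by
    have := hom_aeval (Polynomial.C : ℂ →+* Polynomial ℂ) (fun c => rfl) ![1, 0, 0] fh
    rw [MvPolynomial.aeval_eq_eval, h1, map_one] at this
    rw [this]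
    congr 2
    funext i
    fin_cases i <;> simp [b]
  have hm : m.Monic := Polynomial.monic_of_natDegree_le_of_coeff_eq_one d hdeg (by rw [hco, hb])
  have hm0 : (m.eval 0).eval 0 = 0 := by
    have := hom_aeval ((Polynomial.evalRingHom (0 : ℂ)).comp (Polynomial.evalRingHom (0 : Polynomial ℂ)))
      (fun c => by simp [Polynomial.algebraMap_apply])
      (fun i => Polynomial.C (a i) + Polynomial.X * Polynomial.C (b i)) fh
    rw [MvPolynomial.aeval_eq_eval] at this
    refine this.trans ((congrArg (fun w => MvPolynomial.eval w fh) ?_).trans h0)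
    funext i
    fin_cases i <;> simp [a, b]
  obtain ⟨u, v, hu, hv, hu0, harc⟩ := exists_arc m hm hm0
  refine ⟨u, v, hu, hv, hu0, ?_⟩
  have := hom_aeval (Polynomial.eval₂RingHom
    (Polynomial.aeval u : Polynomial ℂ →ₐ[ℂ] PowerSeries ℂ).toRingHom v)
      (fun c => by simp [Polynomial.algebraMap_apply])
      (fun i => Polynomial.C (a i) + Polynomial.X * Polynomial.C (b i)) fh
  rw [Polynomial.coe_eval₂RingHom] at this
  rw [← harc, this]
  congr 2
  funext i
  fin_cases i <;> simp [a, b]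

theorem gen_case {n d : ℕ} {F : MvPolynomial (Fin 4) ℂ} {e : Fin 3 → Fin 4 → ℂ}
    {fh : MvPolynomial (Fin 3) ℂ} {u v : PowerSeries ℂ} (D : Dat n d F e fh u v)
    (W : Submodule ℂ (Fin 4 → ℂ)) (hW : Module.finrank ℂ W = 3) (he : LinearIndependent ℂ e)
    (heW : ∀ j, e j ∈ W) (f : MvPolynomial (Fin 4) ℂ) (hf : f.IsHomogeneous d)
    (hfh : fh = restr e f) (hf1 : MvPolynomial.eval (e 1) f = 0)
    (P C : Set P3) (hP : P = {x | Projectivization.submodule x ≤ W}) (hC : C = zeroSet f ∩ P) :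
    ∃ Y : Set P3, IsAlgClosedSet Y ∧ ¬ ({p : P3 | p ∉ P} ⊆ Y) ∧
      ∀ p : P3, p ∉ P → p ∉ Y → IsIrredSet (cone C p ∩ zeroSet F) := by
  obtain ⟨hWcc, hfr⟩ := frame W hW e he heW
  have hF0 : MvPolynomial.eval 0 F = 0 := by
    have := homog_scale_eval F n D.hF 0 0
    rwa [zero_smul, zero_pow D.hn.ne', zero_mul] at this
  have hnd : 0 < n * d := Nat.mul_pos D.hn D.hd
  obtain ⟨H, hH, hclA⟩ := D.claimA (n * d - 1) (by omega)
  refine ⟨⋂ g ∈ Set.range (fun m => homogeneousComponent m H), zeroSet g, ⟨_, ?_, rfl⟩, ?_, ?_⟩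
  · rintro _ ⟨m, rfl⟩
    exact ⟨m, homogeneousComponent_isHomogeneous _ _⟩
  · intro hsub
    obtain ⟨p0, hp0⟩ : ∃ p0, p0 ∉ W := by
      by_contra hcon
      push Not at hcon
      have : W = ⊤ := by rw [eq_top_iff]; intro x _; exact hcon x
      rw [this] at hW
      simp at hW
    obtain ⟨l, α, -, -, hα, hαp, -⟩ := hfr p0 hp0
    have hlin : Dat.lin α ≠ 0 := by
      intro h
      have := Dat.eval_lin α p0
      rw [h, hαp] at this
      simp at this
    obtain ⟨w, hw⟩ := exists_eval_ne _ (mul_ne_zero hH hlin)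
    rw [map_mul, Dat.eval_lin] at hw
    have hwW : w ∉ W := by
      intro h
      obtain ⟨y, rfl⟩ := (hWcc w).1 h
      apply right_ne_zero_of_mul hw
      rw [Dat.cc, dotProduct_sum]
      exact Finset.sum_eq_zero fun j _ => by rw [dotProduct_smul, hα, smul_zero]
    have hw0 : w ≠ 0 := by rintro rfl; exact hwW W.zero_mem
    have hm : Projectivization.mk ℂ w hw0 ∈ {p : P3 | p ∉ P} := by
      change _ ∉ P
      rw [hP, mk_mem_plane]; exact hwW
    have h1 := Set.mem_iInter₂.1 (hsub hm)
    apply left_ne_zero_of_mul hw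
    rw [← sum_homogeneousComponent H, map_sum]
    refine Finset.sum_eq_zero fun i _ => ?_
    exact (mk_mem_zeroSet _ i (homogeneousComponent_isHomogeneous _ _) w hw0).1 (h1 _ ⟨i, rfl⟩)
  · intro p hpP hpY
    obtain ⟨p', hp0, hpp, hHp⟩ : ∃ (p' : Fin 4 → ℂ) (hp0 : p' ≠ 0), Projectivization.mk ℂ p' hp0 = p ∧
        MvPolynomial.eval p' H ≠ 0 := by
      induction p using Projectivization.ind with
      | h v' hv' =>
      rw [Set.mem_iInter₂] at hpY
      push Not at hpY
      obtain ⟨_, ⟨m, rfl⟩, hm⟩ := hpY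
      rw [mk_mem_zeroSet _ m (homogeneousComponent_isHomogeneous _ _)] at hm
      have hc := coeff_aeval_lam v' H m
      have hq : MvPolynomial.aeval (fun i => (Polynomial.X * Polynomial.C (v' i) : Polynomial ℂ)) H ≠ 0 := by
        intro h
        rw [h, Polynomial.coeff_zero, MvPolynomial.aeval_eq_eval] at hc
        exact hm hc.symm
      obtain ⟨c, hc⟩ : ∃ c, MvPolynomial.eval (c • v') H ≠ 0 := by
        by_contra hcon
        push Not at hcon
        apply hq
        apply Polynomial.funext
        intro c
        have := hom_aeval (Polynomial.evalRingHom c) (fun r => by simp)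
          (fun i => (Polynomial.X * Polynomial.C (v' i) : Polynomial ℂ)) H
        rw [Polynomial.coe_evalRingHom, MvPolynomial.aeval_eq_eval] at this
        rw [this, Polynomial.eval_zero, ← hcon c]
        congr 2
        funext i
        rw [Polynomial.eval_mul, Polynomial.eval_X, Polynomial.eval_C, Pi.smul_apply, smul_eq_mul]
      have hcv : c • v' ≠ 0 := by
        intro h
        have := (hclA _ hc).1
        rw [h] at this
        exact this hF0
      have hc0 : c ≠ 0 := by rintro rfl; simp at hcv
      refine ⟨c • v', hcv, ?_, hc⟩
      rw [Projectivization.mk_eq_mk_iff']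
      exact ⟨c, rfl⟩
    subst hpp
    have hpW : p' ∉ W := by
      rw [hP, mk_mem_plane] at hpP; exact hpP
    obtain ⟨hpF, t, ht, hind⟩ := hclA p' hHp
    obtain ⟨l, α, hle, hlp, hα, hαp, hrep⟩ := hfr p' hpW
    have hlcc : ∀ y (s : ℂ) j, l j ⬝ᵥ (Dat.cc e y + s • p') = y j := by
      intro y s j
      rw [dotProduct_add, dotProduct_smul, hlp, smul_zero, add_zero, Dat.cc, dotProduct_sum]
      simp [hle]
    have hfy : ∀ y, MvPolynomial.eval y fh = MvPolynomial.eval (Dat.cc e y) f := by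
      intro y; rw [hfh, eval_restr]; rfl
    have hcone : ∀ x (hx : x ≠ 0), Projectivization.mk ℂ x hx ∈ cone C (Projectivization.mk ℂ p' hp0) →
        ∃ y, ∃ s : ℂ, x = Dat.cc e y + s • p' ∧ MvPolynomial.eval y fh = 0 := by
      intro x hx hxc
      obtain ⟨q, hq, hxq⟩ := Set.mem_iUnion₂.1 hxc
      induction q using Projectivization.ind with
      | h q hq0 =>
      rw [hC, hP] at hq
      obtain ⟨hq1, hq2⟩ := hq
      rw [mk_mem_zeroSet f d hf] at hq1
      rw [mk_mem_plane] at hq2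
      obtain ⟨c, s, rfl⟩ := (mk_mem_projSpan _ _ _ _ _ _).1 hxq
      obtain ⟨y, hy⟩ := (hWcc _).1 (W.smul_mem c hq2)
      refine ⟨y, s, by rw [hy], ?_⟩
      rw [hfy, ← hy, homog_scale_eval f d hf, hq1, mul_zero]
    have hmem : ∀ y (s : ℂ), y ≠ 0 → MvPolynomial.eval y fh = 0 → ∀ hx : Dat.cc e y + s • p' ≠ 0,
        Projectivization.mk ℂ _ hx ∈ cone C (Projectivization.mk ℂ p' hp0) := by
      intro y s hy hfy0 hx
      have hcy : Dat.cc e y ≠ 0 := by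
        intro h
        apply hy
        funext j
        have := hlcc y 0 j
        rw [h] at this
        simpa using this.symm
      refine Set.mem_iUnion₂.2 ⟨Projectivization.mk ℂ _ hcy, ?_, ?_⟩
      · rw [hC, hP]
        exact ⟨(mk_mem_zeroSet f d hf _ _).2 (by rw [← hfy, hfy0]), (mk_mem_plane _ _ _).2 ((hWcc _).2 ⟨y, rfl⟩)⟩
      · exact (mk_mem_projSpan _ _ _ _ _ _).2 ⟨1, s, by rw [one_smul]⟩
    have hne : ∀ y (s : ℂ), y ≠ 0 → Dat.cc e y + s • p' ≠ 0 := by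
      intro y s hy h
      apply hy
      funext j
      have := hlcc y s j
      rw [h] at this
      simpa using this.symm
    apply irred_of
    · have he1 : Dat.cc e ![0, 1, 0] + (0 : ℂ) • p' = e 1 := by
        simp [Dat.cc, Fin.sum_univ_three]
      have hy : (![0, 1, 0] : Fin 3 → ℂ) ≠ 0 := fun h => by simpa using congrFun h 1
      refine ⟨Projectivization.mk ℂ _ (hne ![0, 1, 0] 0 hy), hmem _ _ hy ?_ _, ?_⟩
      · rw [hfy]
        rw [zero_smul, add_zero] at he1
        rw [he1, hf1]
      · rw [mk_mem_zeroSet F n D.hF, he1]; exact D.hq0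
    · intro g1 g2 a b hg1 hg2 hsub
      have hE := D.claimE p' hpF t ht (n * d - 1) le_rfl hind l hle hlp (fun x => ⟨_, hrep x⟩) g1 g2 ?_
      · have key : ∀ g (a : ℕ), g.IsHomogeneous a → (∀ y (s : ℂ), MvPolynomial.eval y fh = 0 →
            MvPolynomial.eval (Dat.cc e y + s • p') F = 0 →
            MvPolynomial.eval (Dat.cc e y + s • p') g = 0) →
            cone C (Projectivization.mk ℂ p' hp0) ∩ zeroSet F ⊆ zeroSet g := by
          rintro g a hg h x ⟨hx1, hx2⟩
          induction x using Projectivization.ind with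
          | h x hx0 =>
          obtain ⟨y, s, rfl, hy⟩ := hcone x hx0 hx1
          rw [mk_mem_zeroSet F n D.hF] at hx2
          rw [mk_mem_zeroSet g a hg]
          exact h y s hy hx2
        rcases hE with hE | hE
        · left; exact key g1 a hg1 hE
        · right; exact key g2 b hg2 hE
      · intro y s hy hFy hy0
        have := hsub ⟨hmem y s hy0 hy (hne y s hy0), (mk_mem_zeroSet F n D.hF _ _).2 hFy⟩
        rcases this with h | h
        · rw [mk_mem_zeroSet g1 a hg1] at h; rw [h, zero_mul]
        · rw [mk_mem_zeroSet g2 b hg2] at h; rw [h, mul_zero]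
end
end

section
open scoped LinearAlgebra.Projectivization
open Projectivization MvPolynomial
section

theorem exists_not_mem (W : Submodule ℂ (Fin 4 → ℂ)) (hW : Module.finrank ℂ W = 3) :
    ∃ p0, p0 ∉ W := by
  by_contra hcon
  push Not at hcon
  have : W = ⊤ := by rw [eq_top_iff]; intro x _; exact hcon x
  rw [this] at hW
  simp at hW

theorem fh_irred (W : Submodule ℂ (Fin 4 → ℂ)) (hW : Module.finrank ℂ W = 3)
    (e : Fin 3 → Fin 4 → ℂ) (he : LinearIndependent ℂ e) (heW : ∀ j, e j ∈ W) (d : ℕ) (hd : 0 < d)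
    (f : MvPolynomial (Fin 4) ℂ) (hf : f.IsHomogeneous d)
    (P C : Set P3) (hP : P = {x | Projectivization.submodule x ≤ W}) (hC : C = zeroSet f ∩ P)
    (hirr : IsIrredSet C) (hmin : ∀ d' < d, ¬ IsCurveOfDeg P C d') (h0 : restr e f ≠ 0) :
    Irreducible (restr e f) := by
  obtain ⟨hWcc, hfr⟩ := frame W hW e he heW
  obtain ⟨p0, hp0⟩ := exists_not_mem W hW
  obtain ⟨l, α, hle, -, -, -, -⟩ := hfr p0 hp0
  have hlcc : ∀ y j, l j ⬝ᵥ (Dat.cc e y) = y j := by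
    intro y j
    rw [Dat.cc, dotProduct_sum]
    simp [hle]
  have hlinh : ∀ a, (Dat.lin a).IsHomogeneous 1 := fun a =>
    IsHomogeneous.sum _ _ _ fun j _ => isHomogeneous_C_mul_X (a j) j
  let T : MvPolynomial (Fin 3) ℂ → MvPolynomial (Fin 4) ℂ := fun g =>
    MvPolynomial.aeval (fun j => Dat.lin (l j)) g
  have hT : ∀ g y, MvPolynomial.eval (Dat.cc e y) (T g) = MvPolynomial.eval y g := by
    intro g y
    have := hom_aeval (MvPolynomial.eval (Dat.cc e y))
      (fun c => by rw [MvPolynomial.algebraMap_eq, eval_C]; rfl) (fun j => Dat.lin (l j)) g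
    rw [MvPolynomial.aeval_eq_eval] at this
    refine this.trans ?_
    congr 2
    funext j
    rw [Dat.eval_lin, hlcc]
  have hTh : ∀ g a, g.IsHomogeneous a → (T g).IsHomogeneous a := by
    intro g a hg
    have := hg.aeval (fun j => Dat.lin (l j)) (n := 1) (fun j => hlinh _)
    rwa [one_mul] at this
  refine ⟨homog_pos_not_unit _ d hd (restr_homog e f d hf), ?_⟩
  intro g h hgh
  have hgh0 : g * h ≠ 0 := hgh ▸ h0
  obtain ⟨a, b, ha, hb, hab⟩ := homog_factor g h d (hgh ▸ restr_homog e f d hf) hgh0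
  by_cases ha0 : a = 0
  · subst ha0; left; exact homog_zero_unit g ha (left_ne_zero_of_mul hgh0)
  by_cases hb0 : b = 0
  · subst hb0; right; exact homog_zero_unit h hb (right_ne_zero_of_mul hgh0)
  exfalso
  have hfy : ∀ y, MvPolynomial.eval (Dat.cc e y) f = MvPolynomial.eval y g * MvPolynomial.eval y h := by
    intro y
    rw [← map_mul, ← hgh, eval_restr]; rfl
  have hsub : C ⊆ zeroSet (T g) ∪ zeroSet (T h) := by
    intro x hx
    induction x using Projectivization.ind with
    | h x hx0 =>
    rw [hC, hP] at hx
    obtain ⟨h1, h2⟩ := hx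
    rw [mk_mem_zeroSet f d hf] at h1
    rw [mk_mem_plane] at h2
    obtain ⟨y, rfl⟩ := (hWcc _).1 h2
    rw [hfy] at h1
    rcases mul_eq_zero.1 h1 with h1 | h1
    · left; rw [mk_mem_zeroSet _ a (hTh g a ha), hT, h1]
    · right; rw [mk_mem_zeroSet _ b (hTh h b hb), hT, h1]
  have key : ∀ g a, g.IsHomogeneous a → 0 < a → a < d →
      (∀ y, MvPolynomial.eval y g = 0 → MvPolynomial.eval (Dat.cc e y) f = 0) →
      ¬ C ⊆ zeroSet (T g) := by
    intro g a ha ha0 had hgf hCg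
    refine hmin a had ⟨ha0, T g, hTh g a ha, ?_⟩
    apply Set.Subset.antisymm
    · exact Set.subset_inter hCg (hC ▸ Set.inter_subset_right)
    · rintro x ⟨h1, h2⟩
      rw [hC]
      refine ⟨?_, h2⟩
      induction x using Projectivization.ind with
      | h x hx0 =>
      rw [hP, mk_mem_plane] at h2
      obtain ⟨y, rfl⟩ := (hWcc _).1 h2
      rw [mk_mem_zeroSet _ a (hTh g a ha), hT] at h1
      rw [mk_mem_zeroSet f d hf]
      exact hgf y h1
  rcases hirr.2 _ _ (isAlgClosed_zeroSet _ a (hTh g a ha)) (isAlgClosed_zeroSet _ b (hTh h b hb)) hsub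
    with h1 | h1
  · exact key g a ha (by omega) (by omega) (fun y hy => by rw [hfy, hy, zero_mul]) h1
  · exact key h b hb (by omega) (by omega) (fun y hy => by rw [hfy, hy, mul_zero]) h1

theorem restr_basis (W : Submodule ℂ (Fin 4 → ℂ)) (hW : Module.finrank ℂ W = 3) :
    ∃ b : Fin 3 → Fin 4 → ℂ, LinearIndependent ℂ b ∧ ∀ j, b j ∈ W := by
  let B := Module.finBasisOfFinrankEq ℂ W hW
  refine ⟨fun j => (B j : Fin 4 → ℂ), ?_, fun j => (B j).2⟩
  exact B.linearIndependent.map' W.subtype W.ker_subtype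

theorem case_all (n : ℕ) (hn : 0 < n) (F : MvPolynomial (Fin 4) ℂ) (hF : F.IsHomogeneous n)
    (hFirr : Irreducible F) (W : Submodule ℂ (Fin 4 → ℂ)) (hW : Module.finrank ℂ W = 3)
    (P C : Set P3) (hP : P = {x | Projectivization.submodule x ≤ W}) (hC : C = P) :
    ∃ Y : Set P3, IsAlgClosedSet Y ∧ ¬ ({p : P3 | p ∉ P} ⊆ Y) ∧
      ∀ p : P3, p ∉ P → p ∉ Y → IsIrredSet (cone C p ∩ zeroSet F) := by
  obtain ⟨b, hb, hbW⟩ := restr_basis W hW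
  obtain ⟨hWcc, hfr⟩ := frame W hW b hb hbW
  obtain ⟨p0, hp0⟩ := exists_not_mem W hW
  obtain ⟨y, hy0, hy, -⟩ := bez3 _ _ n n hn hn (restr_homog b F n hF) (restr_homog b F n hF)
  rw [eval_restr] at hy
  have hv0 : ∑ j, y j • b j ≠ 0 := by
    intro h
    apply hy0
    funext j
    exact Fintype.linearIndependent_iff.1 hb y h j
  have hS := irred_surface n F hF hFirr _ hv0 hy
  have hp00 : p0 ≠ 0 := by rintro rfl; exact hp0 W.zero_mem
  refine ⟨zeroSet 1, isAlgClosed_zeroSet 1 0 (isHomogeneous_one _ _), ?_, ?_⟩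
  · intro h
    have hm : Projectivization.mk ℂ p0 hp00 ∈ {p : P3 | p ∉ P} := by
      change _ ∉ P
      rw [hP, mk_mem_plane]; exact hp0
    have := (mk_mem_zeroSet 1 0 (isHomogeneous_one _ _) _ _).1 (h hm)
    simp at this
  · intro p hpP _
    suffices h : cone C p = Set.univ by rw [h, Set.univ_inter]; exact hS
    rw [Set.eq_univ_iff_forall]
    intro x
    induction p using Projectivization.ind with
    | h p hp1 =>
    induction x using Projectivization.ind with
    | h x hx0 =>
    rw [hP, mk_mem_plane] at hpP
    obtain ⟨l, α, -, -, -, -, hrep⟩ := hfr p hpP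
    have hx := hrep x
    by_cases hz : Dat.cc b (fun j => l j ⬝ᵥ x) = 0
    · refine Set.mem_iUnion₂.2 ⟨Projectivization.mk ℂ _ hv0, ?_, ?_⟩
      · rw [hC, hP, mk_mem_plane]; exact (hWcc _).2 ⟨y, rfl⟩
      · refine (mk_mem_projSpan _ _ _ _ _ _).2 ⟨0, α ⬝ᵥ x, ?_⟩
        rw [hz] at hx
        rw [zero_smul]; exact hx.symm
    · refine Set.mem_iUnion₂.2 ⟨Projectivization.mk ℂ _ hz, ?_, ?_⟩
      · rw [hC, hP, mk_mem_plane]; exact (hWcc _).2 ⟨_, rfl⟩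
      · refine (mk_mem_projSpan _ _ _ _ _ _).2 ⟨1, α ⬝ᵥ x, ?_⟩
        rw [one_smul]; exact hx.symm

end
open Classical in
theorem cone_inter_surface_irreducible_aux
    (n : ℕ) (hn : 0 < n) (F : MvPolynomial (Fin 4) ℂ) (hF : F.IsHomogeneous n)
    (hsmooth : ∀ v : Fin 4 → ℂ, v ≠ 0 → eval v F = 0 →
      ∃ i : Fin 4, eval v (pderiv i F) ≠ 0)
    (P C : Set P3) (hP : IsPlane P)
    (hC : IsIrrCurve P C)
    (hCS : ¬ C ⊆ zeroSet F) :
    ∃ Y : Set P3, IsAlgClosedSet Y ∧ ¬ ({p : P3 | p ∉ P} ⊆ Y) ∧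
      ∀ p : P3, p ∉ P → p ∉ Y → IsIrredSet (cone C p ∩ zeroSet F) := by
  have hFirr := irred_of_smooth n hn F hF hsmooth
  obtain ⟨W, hW, hP⟩ := hP
  obtain ⟨hex, hirr⟩ := hC
  have hmin := fun d' => Nat.find_min hex (m := d')
  have hsp := Nat.find_spec hex
  generalize Nat.find hex = d at hmin hsp
  obtain ⟨hd, f, hf, hCf⟩ := hsp
  by_cases hvan : ∀ w ∈ W, MvPolynomial.eval w f = 0
  · refine case_all n hn F hF hFirr W hW P C hP ?_
    rw [hCf, Set.inter_eq_right]
    intro x hx w hw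
    rw [hP] at hx
    exact hvan w (hx hw)
  push Not at hvan
  obtain ⟨w1, hw1, hfw1⟩ := hvan
  obtain ⟨b, hb, hbW⟩ := restr_basis W hW
  obtain ⟨hWcc, -⟩ := frame W hW b hb hbW
  obtain ⟨w2, hw2, hw20, hfw2, hFw2⟩ : ∃ w ∈ W, w ≠ 0 ∧ MvPolynomial.eval w f = 0 ∧ MvPolynomial.eval w F ≠ 0 := by
    rw [Set.not_subset] at hCS
    obtain ⟨x, hx, hxF⟩ := hCS
    induction x using Projectivization.ind with
    | h x hx0 =>
    rw [hCf, hP] at hx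
    obtain ⟨h1, h2⟩ := hx
    rw [mk_mem_zeroSet f d hf] at h1
    rw [mk_mem_plane] at h2
    rw [mk_mem_zeroSet F n hF] at hxF
    exact ⟨x, h2, hx0, h1, hxF⟩
  have hrf : restr b f ≠ 0 := by
    intro h
    obtain ⟨y, rfl⟩ := (hWcc _).1 hw1
    apply hfw1
    rw [Dat.cc, ← eval_restr, h, map_zero]
  have hrF : restr b F ≠ 0 := by
    intro h
    obtain ⟨y, rfl⟩ := (hWcc _).1 hw2
    apply hFw2
    rw [Dat.cc, ← eval_restr, h, map_zero]
  obtain ⟨y0, hy0⟩ := exists_eval_ne _ (mul_ne_zero hrf hrF)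
  rw [map_mul, eval_restr, eval_restr] at hy0
  obtain ⟨e0, he0⟩ : ∃ e0, e0 = ∑ j, y0 j • b j := ⟨_, rfl⟩
  rw [← he0] at hy0
  have hfe0 := left_ne_zero_of_mul hy0
  have hFe0 := right_ne_zero_of_mul hy0
  have he0W : e0 ∈ W := (hWcc _).2 ⟨y0, he0⟩
  obtain ⟨y1, hy10, hfe1, hFe1⟩ := bez3 _ _ d n hd hn (restr_homog b f d hf) (restr_homog b F n hF)
  rw [eval_restr] at hfe1 hFe1
  have hq0 : ∑ j, y1 j • b j ≠ 0 := by
    intro h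
    apply hy10
    funext j
    exact Fintype.linearIndependent_iff.1 hb y1 h j
  obtain ⟨e1, he1⟩ : ∃ e1, e1 = ∑ j, y1 j • b j := ⟨_, rfl⟩
  rw [← he1] at hfe1 hFe1 hq0
  have he1W : e1 ∈ W := (hWcc _).2 ⟨y1, he1⟩
  have he10 : e1 ∉ Submodule.span ℂ {e0} := by
    intro h
    obtain ⟨c, rfl⟩ := Submodule.mem_span_singleton.1 h
    rw [homog_scale_eval f d hf] at hfe1
    rcases mul_eq_zero.1 hfe1 with h | h
    · apply hq0
      rw [pow_eq_zero_iff hd.ne'] at h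
      rw [h, zero_smul]
    · exact hfe0 h
  have he00 : e0 ≠ 0 := by
    rintro rfl
    have := homog_scale_eval F n hF 0 0
    rw [zero_smul, zero_pow hn.ne', zero_mul] at this
    exact hFe0 this
  have hli2 : LinearIndependent ℂ ![e0, e1] := by
    rw [LinearIndependent.pair_iff' he00]
    intro a ha
    exact he10 (Submodule.mem_span_singleton.2 ⟨a, ha⟩)
  obtain ⟨e2, he2W, he2⟩ : ∃ e2 ∈ W, e2 ∉ Submodule.span ℂ (Set.range ![e0, e1]) := by
    by_contra hcon
    push Not at hcon
    have h1 : W ≤ Submodule.span ℂ (Set.range ![e0, e1]) := hcon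
    have h2 := Submodule.finrank_mono h1
    rw [hW, finrank_span_eq_card hli2] at h2
    simp at h2
  have hli3 : LinearIndependent ℂ (![e0, e1, e2] : Fin 3 → Fin 4 → ℂ) := by
    have := linearIndependent_finSnoc.2 ⟨hli2, he2⟩
    have h3 : (![e0, e1, e2] : Fin 3 → Fin 4 → ℂ) =
        (Fin.snoc ![e0, e1] e2 : Fin 3 → Fin 4 → ℂ) := by
      funext i
      fin_cases i <;> rfl
    rw [h3]
    exact this
  have heW : ∀ j, (![e0, e1, e2] : Fin 3 → Fin 4 → ℂ) j ∈ W := by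
    intro j
    fin_cases j
    · exact he0W
    · exact he1W
    · exact he2W
  obtain ⟨f', hf'⟩ : ∃ f', f' = MvPolynomial.C (MvPolynomial.eval e0 f)⁻¹ * f := ⟨_, rfl⟩
  have hf'h : f'.IsHomogeneous d := by rw [hf']; exact hf.C_mul _
  have hf'e : ∀ x, MvPolynomial.eval x f' = (MvPolynomial.eval e0 f)⁻¹ * MvPolynomial.eval x f := by
    intro x; rw [hf', map_mul, eval_C]
  have hf'z : ∀ x, MvPolynomial.eval x f' = 0 ↔ MvPolynomial.eval x f = 0 := by
    intro x; rw [hf'e, mul_eq_zero, inv_eq_zero, or_iff_right hfe0]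
  have hCf' : C = zeroSet f' ∩ P := by
    rw [hCf]
    congr 1
    ext x
    exact forall₂_congr fun w _ => (hf'z w).symm
  obtain ⟨e, he⟩ : ∃ e : Fin 3 → Fin 4 → ℂ, e = ![e0, e1, e2] := ⟨_, rfl⟩
  rw [← he] at hli3 heW
  have hee0 : e 0 = e0 := by rw [he]; rfl
  have hee1 : e 1 = e1 := by rw [he]; rfl
  have hl : MvPolynomial.eval ![1, 0, 0] (restr e f') = 1 := by
    rw [eval_restr]
    have : ∑ j, (![1, 0, 0] : Fin 3 → ℂ) j • e j = e0 := by
      simp [Fin.sum_univ_three, hee0]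
    rw [this, hf'e, inv_mul_cancel₀ hfe0]
  have hl0 : MvPolynomial.eval ![0, 1, 0] (restr e f') = 0 := by
    rw [eval_restr]
    have : ∑ j, (![0, 1, 0] : Fin 3 → ℂ) j • e j = e1 := by
      simp [Fin.sum_univ_three, hee1]
    rw [this, hf'z, hfe1]
  have hne : restr e f' ≠ 0 := by
    intro h
    rw [h, map_zero] at hl
    exact zero_ne_one hl
  obtain ⟨u, v, hu, hv, hu0, harc⟩ := arc_of _ d (restr_homog e f' d hf'h) hl hl0
  have D : Dat n d F e (restr e f') u v :=
    { hn := hn, hd := hd, hF := hF, hFirr := hFirr, hfh := restr_homog e f' d hf'h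
      hirr := fh_irred W hW e hli3 heW d hd f' hf'h P C hP hCf' hirr (fun d' h => hmin d' h) hne
      hlead := hl
      hFe := by rw [hee0]; exact hFe0
      hu := hu, hv := hv, hu0 := hu0, harc := harc
      hq0 := by rw [hee1]; exact hFe1
      hsm := by rw [hee1]; exact hsmooth e1 hq0 hFe1
      hndvd := by
        rintro ⟨q, hq⟩
        obtain ⟨y, rfl⟩ := ((frame W hW e hli3 heW).1 _).1 hw2
        apply hFw2
        rw [Dat.cc, ← eval_restr, hq, map_mul, eval_restr, (hf'z _).2, zero_mul]
        exact hfw2 }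
  exact gen_case D W hW hli3 heW f' hf'h rfl (by rw [hee1, hf'z, hfe1]) P C hP hCf'
end

/-- Let `Σ = {F = 0} ⊂ ℙ³` be a smooth projective surface, `P` a plane with
`P ≠ Σ`, and `C ⊆ P` an irreducible curve which is not a line and not contained
in `Σ`. Then for a general `p ∈ ℙ³ \ P` (i.e. all `p` outside `P` and outside
some algebraic closed set not containing `ℙ³ \ P`) the curve `K_{C,p} ∩ Σ` is
irreducible. -/
theorem cone_inter_surface_irreducible
    (n : ℕ) (hn : 0 < n) (F : MvPolynomial (Fin 4) ℂ) (hF : F.IsHomogeneous n)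
    (hsmooth : ∀ v : Fin 4 → ℂ, v ≠ 0 → eval v F = 0 →
      ∃ i : Fin 4, eval v (pderiv i F) ≠ 0)
    (P C : Set P3) (hP : IsPlane P) (hPS : P ≠ zeroSet F)
    (hCP : C ⊆ P) (hC : IsIrrCurve P C) (hnl : ¬ IsLine C)
    (hCS : ¬ C ⊆ zeroSet F) :
    ∃ Y : Set P3, IsAlgClosedSet Y ∧ ¬ ({p : P3 | p ∉ P} ⊆ Y) ∧
      ∀ p : P3, p ∉ P → p ∉ Y → IsIrredSet (cone C p ∩ zeroSet F) := by
  exact cone_inter_surface_irreducible_aux n hn F hF hsmooth P C hP hC hCS
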